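/- arXiv:1906.11207 — 4 statements merged into one kernel-verified Lean document; each statement's English description precedes it below -/
import Mathlib

section
/- Let G be a finite meta-nilpotent group of odd order whose order has exactly two prime divisors p₁ and p₂, and let χ be a primitive irreducible complex character of G. Then there exists g ∈ G such that χ(1) divides |cl_G(g)|. -/
open scoped Classical

/-- `χ : G → ℂ` is the character of some finite-dimensional complex representation of `G`. -/
def IsChar {G : Type*} [Group G] (χ : G → ℂ) : Prop :=
  ∃ (V : Type) (_ : AddCommGroup V) (_ : Module ℂ V) (_ : FiniteDimensional ℂ V)
    (ρ : Representation ℂ G V), ∀ g : G, χ g = LinearMap.trace ℂ V (ρ g)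

/-- `χ : G → ℂ` is the character of some irreducible finite-dimensional complex
representation of `G`. -/
def IsIrreducibleChar {G : Type*} [Group G] (χ : G → ℂ) : Prop :=
  ∃ (V : Type) (_ : AddCommGroup V) (_ : Module ℂ V) (_ : FiniteDimensional ℂ V)
    (ρ : Representation ℂ G V), Nontrivial V ∧
      (∀ U : Submodule ℂ V, (∀ g : G, ∀ v ∈ U, ρ g v ∈ U) → U = ⊥ ∨ U = ⊤) ∧
      ∀ g : G, χ g = LinearMap.trace ℂ V (ρ g)

/-- The class function of `G` induced from the function `ψ` on a subgroup `H`. -/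
noncomputable def inducedChar {G : Type*} [Group G] [Fintype G] (H : Subgroup G)
    (ψ : ↥H → ℂ) : G → ℂ :=
  fun g => (Nat.card H : ℂ)⁻¹ *
    ∑ x : G, if h : x⁻¹ * g * x ∈ H then ψ ⟨x⁻¹ * g * x, h⟩ else 0

/-- An irreducible character is primitive if it is not induced from a character of any
proper subgroup. -/
def IsPrimitiveChar {G : Type*} [Group G] [Fintype G] (χ : G → ℂ) : Prop :=
  IsIrreducibleChar χ ∧
    ∀ H : Subgroup G, H ≠ ⊤ → ∀ ψ : ↥H → ℂ, IsChar ψ → χ ≠ inducedChar H ψ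

/-- The size of the conjugacy class of `g` in `G`. -/
noncomputable def classSize {G : Type*} [Group G] (g : G) : ℕ :=
  Nat.card {x : G // IsConj g x}

/-- The `p`-part of a natural number `n`, i.e. the largest power of `p` dividing `n`. -/
def pPart (p n : ℕ) : ℕ := p ^ (n.factorization p)

namespace Representation

/-- The representation `ρ` has no nontrivial system of imprimitivity: a nonzero subspace which is
independent from the sum of its other translates is the whole space. -/
def IsPrimitive {G V : Type*} [Group G] [AddCommGroup V] [Module ℂ V]
    (ρ : Representation ℂ G V) : Prop :=
  ∀ U : Submodule ℂ V, U ≠ ⊥ →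
    Disjoint U (⨆ y : {y : G // U.map (ρ y) ≠ U}, U.map (ρ y)) → U = ⊤

section Induced

variable {G V : Type*} [Group G] [AddCommGroup V] [Module ℂ V] (ρ : Representation ℂ G V)

/-- The stabilizer of a subspace in a representation. -/
def subspaceStabilizer (U : Submodule ℂ V) : Subgroup G where
  carrier := {g | U.map (ρ g) = U}
  one_mem' := by
    change U.map (ρ 1) = U
    rw [map_one]
    exact Submodule.map_id U
  mul_mem' {a b} ha hb := by
    change U.map (ρ (a * b)) = U
    change U.map (ρ a) = U at ha
    change U.map (ρ b) = U at hb
    rw [map_mul]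
    change U.map (ρ a ∘ₗ ρ b) = U
    rw [Submodule.map_comp, hb, ha]
  inv_mem' {a} ha := by
    change U.map (ρ a⁻¹) = U
    change U.map (ρ a) = U at ha
    conv_lhs => rw [← ha]
    rw [← Submodule.map_comp]
    change U.map (ρ a⁻¹ * ρ a) = U
    rw [← map_mul, inv_mul_cancel, map_one]
    exact Submodule.map_id U

variable {ρ}

theorem mem_subspaceStabilizer {U : Submodule ℂ V} {g : G} :
    g ∈ ρ.subspaceStabilizer U ↔ U.map (ρ g) = U := Iff.rfl

/-- The representation of the stabilizer of a subspace on that subspace. -/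
noncomputable def stabilizerRep (ρ : Representation ℂ G V) (U : Submodule ℂ V) :
    Representation ℂ (ρ.subspaceStabilizer U) U where
  toFun h := (ρ h).restrict fun u hu => by
    have h2 : U.map (ρ h) = U := h.2
    have h3 := Submodule.mem_map_of_mem (f := ρ h) hu
    rwa [h2] at h3
  map_one' := by ext; simp
  map_mul' x y := by ext; simp

theorem trace_eq_inducedChar [Fintype G] [FiniteDimensional ℂ V] (U : Submodule ℂ V)
    (hU : Disjoint U (⨆ y : {y : G // U.map (ρ y) ≠ U}, U.map (ρ y)))
    (htop : ⨆ y : G, U.map (ρ y) = ⊤) (g : G) :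
    LinearMap.trace ℂ V (ρ g) =
      inducedChar (ρ.subspaceStabilizer U)
        (fun h => LinearMap.trace ℂ U (ρ.stabilizerRep U h)) g := by
  set W := ⨆ y : {y : G // U.map (ρ y) ≠ U}, U.map (ρ y) with hW
  set H := ρ.subspaceStabilizer U with hH
  have hc : IsCompl U W := by
    refine ⟨hU, ?_⟩
    rw [codisjoint_iff_le_sup, ← htop]
    refine iSup_le fun y => ?_
    by_cases hy : U.map (ρ y) = U
    · exact hy.le.trans le_sup_left
    · exact (le_iSup (fun y : {y : G // U.map (ρ y) ≠ U} => U.map (ρ y)) ⟨y, hy⟩).trans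
        le_sup_right
  set P := U.projectionOnto W hc with hP
  set π : V →ₗ[ℂ] V := U.subtype ∘ₗ P with hπ
  have hπU : ∀ y ∈ H, ∀ u ∈ U, π (ρ y u) = ρ y u := by
    intro y hy u hu
    have : ρ y u ∈ U := by
      have := Submodule.mem_map_of_mem (f := ρ y) hu
      rwa [mem_subspaceStabilizer.1 hy] at this
    simp [hπ, hP, Submodule.projectionOnto_apply_of_mem_left hc this]
  have hπ0 : ∀ y ∉ H, ∀ u ∈ U, π (ρ y u) = 0 := by
    intro y hy u hu
    have : ρ y u ∈ W :=
      (le_iSup (fun y : {y : G // U.map (ρ y) ≠ U} => U.map (ρ y)) ⟨y, hy⟩)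
        (Submodule.mem_map_of_mem hu)
    simp [hπ, hP, Submodule.projectionOnto_apply_of_mem_right hc this]
  have hsum : ∑ x : G, ρ x * π * ρ x⁻¹ = (Nat.card H : ℂ) • (1 : Module.End ℂ V) := by
    refine LinearMap.ext fun v => ?_
    have hv : v ∈ ⨆ y : G, U.map (ρ y) := htop ▸ Submodule.mem_top
    induction hv using Submodule.iSup_induction' with
    | zero => simp
    | add a b _ _ ha hb => rw [map_add, map_add, ha, hb]
    | mem y v hv =>
      obtain ⟨u, hu, rfl⟩ := hv
      have key : ∀ x : G, (ρ x * π * ρ x⁻¹) (ρ y u) = if x⁻¹ * y ∈ H then ρ y u else 0 := by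
        intro x
        have e : (ρ x * π * ρ x⁻¹) (ρ y u) = ρ x (π (ρ (x⁻¹ * y) u)) := by
          simp [map_mul]
        rw [e]
        split_ifs with h
        · rw [hπU _ h _ hu]
          rw [← Module.End.mul_apply, ← map_mul]
          simp
        · rw [hπ0 _ h _ hu, map_zero]
      rw [LinearMap.sum_apply, Finset.sum_congr rfl fun x _ => key x, Finset.sum_ite,
        Finset.sum_const_zero, add_zero, Finset.sum_const]
      have hcard : (Finset.univ.filter fun x : G => x⁻¹ * y ∈ H).card = Nat.card H := by
        rw [← Fintype.card_subtype, ← Nat.card_eq_fintype_card]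
        refine Nat.card_congr ⟨fun x => ⟨x.1⁻¹ * y, x.2⟩, fun h => ⟨y * h.1⁻¹, by simp⟩, ?_, ?_⟩
        · intro x; simp
        · intro x; simp
      rw [hcard]
      simp [Nat.cast_smul_eq_nsmul]
  have htr : ∀ y : G, LinearMap.trace ℂ V (ρ y * π) =
      if h : y ∈ H then LinearMap.trace ℂ U (ρ.stabilizerRep U ⟨y, h⟩) else 0 := by
    intro y
    split_ifs with h
    · have : ρ y * π = (ρ y ∘ₗ U.subtype) ∘ₗ P := rfl
      rw [this, LinearMap.trace_comp_comm']
      congr 1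
      ext u
      have := hπU y h u u.2
      simpa [hπ, stabilizerRep] using this
    · have hππ : π * π = π := by
        refine LinearMap.ext fun v => ?_
        have := hπU 1 H.one_mem (P v) (P v).2
        simpa [hπ] using this
      have : π * (ρ y * π) = 0 := by
        refine LinearMap.ext fun v => ?_
        exact hπ0 y h (P v) (P v).2
      rw [← hππ, ← mul_assoc, LinearMap.trace_mul_comm, this, map_zero]
  have hne : (Nat.card H : ℂ) ≠ 0 := by
    exact_mod_cast Nat.card_pos.ne'
  have hfin : (Nat.card H : ℂ) * LinearMap.trace ℂ V (ρ g) =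
      ∑ x : G, LinearMap.trace ℂ V (ρ (x⁻¹ * g * x) * π) := by
    have : (Nat.card H : ℂ) • ρ g = ∑ x : G, ρ g * (ρ x * π * ρ x⁻¹) := by
      rw [← Finset.mul_sum, hsum, mul_smul_comm, mul_one]
    rw [← smul_eq_mul, ← map_smul, this, map_sum]
    refine Finset.sum_congr rfl fun x _ => ?_
    rw [← mul_assoc, LinearMap.trace_mul_comm]
    simp only [map_mul, mul_assoc]
  rw [inducedChar, eq_inv_mul_iff_mul_eq₀ hne, hfin]
  exact Finset.sum_congr rfl fun x _ => htr _

end Induced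

/-- A representation affording a primitive character has no system of imprimitivity. -/
theorem isPrimitive_of_not_induced {G : Type*} {V : Type} [Group G] [Fintype G] [AddCommGroup V]
    [Module ℂ V] [FiniteDimensional ℂ V] (ρ : Representation ℂ G V)
    (hirr : ∀ U : Submodule ℂ V, (∀ g : G, ∀ v ∈ U, ρ g v ∈ U) → U = ⊥ ∨ U = ⊤)
    (hprim : ∀ H : Subgroup G, H ≠ ⊤ → ∀ ψ : ↥H → ℂ, IsChar ψ →
      (fun g => LinearMap.trace ℂ V (ρ g)) ≠ inducedChar H ψ) :
    ρ.IsPrimitive := by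
  intro U hU hd
  have htop : ⨆ y : G, U.map (ρ y) = ⊤ := by
    refine (hirr _ fun g v hv => ?_).resolve_left fun h => hU ?_
    · induction hv using Submodule.iSup_induction' with
      | zero => simp
      | add a b _ _ ha hb => rw [map_add]; exact add_mem ha hb
      | mem y v hv =>
        obtain ⟨u, hu, rfl⟩ := hv
        rw [← Module.End.mul_apply, ← map_mul]
        exact Submodule.mem_iSup_of_mem (g * y) (Submodule.mem_map_of_mem hu)
    · have := (iSup_eq_bot.1 h) 1
      rw [map_one] at this
      simpa [Module.End.one_eq_id] using this
  have hs : ρ.subspaceStabilizer U = ⊤ := by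
    by_contra hne
    refine hprim _ hne _ ⟨U, inferInstance, inferInstance, inferInstance,
      ρ.stabilizerRep U, fun _ => rfl⟩ (funext fun g => ?_)
    exact trace_eq_inducedChar U hd htop g
  refine (hirr U fun g v hv => ?_).resolve_left hU
  have : g ∈ ρ.subspaceStabilizer U := hs ▸ Subgroup.mem_top g
  exact (mem_subspaceStabilizer.1 this) ▸ Submodule.mem_map_of_mem hv

end Representation

namespace Representation

open scoped commutatorElement

theorem exists_common_eigenvector {E ι : Type*} [AddCommGroup E] [Module ℂ E]
    [FiniteDimensional ℂ E] (T : ι → Module.End ℂ E) (C : Submodule ℂ E) (hC : C ≠ ⊥)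
    (hmap : ∀ i, ∀ x ∈ C, T i x ∈ C)
    (hcomm : ∀ i j, ∀ x ∈ C, T i (T j x) = T j (T i x)) :
    ∃ x ∈ C, x ≠ 0 ∧ ∀ i, ∃ c : ℂ, T i x = c • x := by
  induction hn : Module.finrank ℂ C using Nat.strong_induction_on generalizing C with
  | _ n ih =>
  by_cases hs : ∀ i, ∃ c : ℂ, ∀ x ∈ C, T i x = c • x
  · obtain ⟨x, hx, hx0⟩ := Submodule.exists_mem_ne_zero_of_ne_bot hC
    exact ⟨x, hx, hx0, fun i => (hs i).imp fun c hc => hc x hx⟩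
  · push Not at hs
    obtain ⟨i, hi⟩ := hs
    have : Nontrivial C := Submodule.nontrivial_iff_ne_bot.2 hC
    obtain ⟨c, hc⟩ := Module.End.exists_eigenvalue ((T i).restrict (hmap i))
    obtain ⟨v, hv⟩ := hc.exists_hasEigenvector
    set D : Submodule ℂ E := C ⊓ Module.End.eigenspace (T i) c with hD
    have hvD : (v : E) ∈ D := by
      refine ⟨v.2, ?_⟩
      rw [SetLike.mem_coe, Module.End.mem_eigenspace_iff]
      exact congrArg Subtype.val hv.apply_eq_smul
    have hDC : D < C := by
      refine lt_of_le_of_ne inf_le_left fun h => ?_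
      obtain ⟨x, hx, hxc⟩ := hi c
      rw [← h] at hx
      exact hxc (Module.End.mem_eigenspace_iff.1 hx.2)
    obtain ⟨x, hx, hx0, h⟩ := ih _ (hn ▸ Submodule.finrank_lt_finrank_of_lt hDC) D
      (fun h => hv.2 (by
        rw [h, Submodule.mem_bot] at hvD
        exact Subtype.ext hvD))
      (fun j x hx => by
        refine ⟨hmap j x hx.1, ?_⟩
        rw [SetLike.mem_coe, Module.End.mem_eigenspace_iff, hcomm i j x hx.1,
          Module.End.mem_eigenspace_iff.1 hx.2, map_smul])
      (fun j k x hx => hcomm j k x hx.1) rfl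
    exact ⟨x, hx.1, hx0, h⟩

variable {G V : Type*} [Group G] [AddCommGroup V] [Module ℂ V] {ρ : Representation ℂ G V}

theorem mul_inv_eq_one (ρ : Representation ℂ G V) (g : G) : ρ g * ρ g⁻¹ = 1 := by
  rw [← map_mul]
  simp

theorem inv_mul_eq_one (ρ : Representation ℂ G V) (g : G) : ρ g⁻¹ * ρ g = 1 := by
  rw [← map_mul]
  simp

theorem apply_injective (ρ : Representation ℂ G V) (g : G) : Function.Injective (ρ g) :=
  Function.LeftInverse.injective (g := ρ g⁻¹) fun v => by
    simp

section Primitive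

variable [FiniteDimensional ℂ V]

theorem IsPrimitive.eq_top_of_iSupIndep (hp : ρ.IsPrimitive) {ι : Type*} {E : ι → Submodule ℂ V}
    (hE : iSupIndep E) (i : ι) (hi : E i ≠ ⊥) (hmap : ∀ g, ∃ j, (E i).map (ρ g) ≤ E j) :
    E i = ⊤ := by
  refine hp _ hi ((hE i).mono_right (iSup_le fun y => ?_))
  obtain ⟨j, hj⟩ := hmap y
  have hji : j ≠ i := by
    rintro rfl
    refine y.2 (Submodule.eq_of_le_of_finrank_eq hj ?_)
    exact (Submodule.equivMapOfInjective _ (apply_injective ρ y) _).finrank_eq.symm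
  exact hj.trans (le_iSup₂_of_le j hji le_rfl)

theorem IsPrimitive.eq_bot_or_eq_top (hp : ρ.IsPrimitive) (U : Submodule ℂ V)
    (hU : ∀ g : G, ∀ v ∈ U, ρ g v ∈ U) : U = ⊥ ∨ U = ⊤ := by
  by_cases h : U = ⊥
  · exact Or.inl h
  · refine Or.inr (hp.eq_top_of_iSupIndep (E := fun _ : Unit => U)
      (iSupIndep_subsingleton _) () h fun g => ⟨(), ?_⟩)
    rintro _ ⟨u, hu, rfl⟩
    exact hU g u hu

/-- An operator which is a simultaneous eigenvector for the conjugation action is a scalar. -/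
theorem IsPrimitive.eq_smul_one_of_forall_mul_eq [Nontrivial V] (hp : ρ.IsPrimitive)
    (x : Module.End ℂ V) (hx : ∀ g, ∃ c : ℂ, x * ρ g = c • (ρ g * x)) :
    ∃ c : ℂ, x = c • 1 := by
  obtain ⟨μ, hμ⟩ := Module.End.exists_eigenvalue x
  refine ⟨μ, ?_⟩
  have := hp.eq_top_of_iSupIndep x.eigenspaces_iSupIndep μ hμ fun g => by
    obtain ⟨c, hc⟩ := hx g
    refine ⟨c * μ, ?_⟩
    rintro _ ⟨u, hu, rfl⟩
    rw [Module.End.mem_eigenspace_iff, ← Module.End.mul_apply, hc]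
    simp [Module.End.mem_eigenspace_iff.1 hu, smul_smul]
  refine LinearMap.ext fun v => ?_
  have hv : v ∈ Module.End.eigenspace x μ := this ▸ Submodule.mem_top
  simpa using Module.End.mem_eigenspace_iff.1 hv

theorem IsPrimitive.eq_smul_one_of_commute [Nontrivial V] (hp : ρ.IsPrimitive) (A : Subgroup G)
    [A.Normal] (hA : ∀ a ∈ A, ∀ b ∈ A, Commute (ρ a) (ρ b)) :
    ∀ a ∈ A, ∃ c : ℂ, ρ a = c • 1 := by
  have hind : iSupIndep fun χ : A → ℂ => ⨅ a : A, Module.End.eigenspace (ρ a) (χ a) := by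
    refine (Module.End.independent_iInf_maxGenEigenspace_of_forall_mapsTo
      (fun a : A => ρ a) fun i j φ => ?_).mono fun χ => ?_
    · exact Module.End.mapsTo_maxGenEigenspace_of_comm (hA j j.2 i i.2) φ
    · exact iInf_mono fun a => Module.End.eigenspace_le_maxGenEigenspace
  obtain ⟨v, -, hv0, hv⟩ := exists_common_eigenvector (fun a : A => ρ a) (⊤ : Submodule ℂ V)
    top_ne_bot (fun _ _ _ => Submodule.mem_top) (fun i j x _ => by
      rw [← Module.End.mul_apply, (hA i i.2 j j.2).eq, Module.End.mul_apply])
  choose w hw using hv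
  have htop := hp.eq_top_of_iSupIndep hind w
    (fun h => hv0 ((Submodule.mem_bot ℂ).1 (h ▸ (Submodule.mem_iInf _).2 fun a =>
      Module.End.mem_eigenspace_iff.2 (hw a)))) fun g => by
    have hconj : ∀ a : A, g⁻¹ * a * g ∈ A := fun a => by
      simpa using ‹A.Normal›.conj_mem a a.2 g⁻¹
    refine ⟨fun a => w ⟨g⁻¹ * a * g, hconj a⟩, ?_⟩
    rintro _ ⟨u, hu, rfl⟩
    refine (Submodule.mem_iInf _).2 fun a => Module.End.mem_eigenspace_iff.2 ?_
    have h1 := Module.End.mem_eigenspace_iff.1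
      ((Submodule.mem_iInf _).1 hu ⟨g⁻¹ * a * g, hconj a⟩)
    have h2 : ρ a (ρ g u) = ρ g (ρ (g⁻¹ * a * g) u) := by
      rw [← Module.End.mul_apply, ← Module.End.mul_apply, ← map_mul, ← map_mul]
      congr 2
      group
    rw [h2, h1, map_smul]
  intro a ha
  refine ⟨w ⟨a, ha⟩, LinearMap.ext fun v => ?_⟩
  have hv : v ∈ ⨅ a : A, Module.End.eigenspace (ρ a) (w a) := htop ▸ Submodule.mem_top
  simpa using Module.End.mem_eigenspace_iff.1 ((Submodule.mem_iInf _).1 hv ⟨a, ha⟩)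

end Primitive

/-- The subgroup of elements acting as scalars. -/
def scalarSubgroup (ρ : Representation ℂ G V) : Subgroup G where
  carrier := {g | ∃ c : ℂ, ρ g = c • 1}
  one_mem' := ⟨1, by simp⟩
  mul_mem' := by
    rintro a b ⟨c, hc⟩ ⟨d, hd⟩
    exact ⟨c * d, by rw [map_mul, hc, hd, smul_mul_smul_comm, mul_one]⟩
  inv_mem' := by
    rintro a ⟨c, hc⟩
    by_cases h0 : c = 0
    · refine ⟨0, ?_⟩
      have h1 : ρ a⁻¹ * ρ a = 1 := inv_mul_eq_one ρ a
      rw [hc, h0, zero_smul, mul_zero] at h1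
      rw [zero_smul, ← mul_one (ρ a⁻¹), ← h1, mul_zero]
    · refine ⟨c⁻¹, ?_⟩
      have h1 : ρ a⁻¹ * ρ a = 1 := inv_mul_eq_one ρ a
      rw [hc, mul_smul_comm, mul_one] at h1
      rw [← h1, smul_smul, inv_mul_cancel₀ h0, one_smul]

theorem mem_scalarSubgroup {g : G} : g ∈ ρ.scalarSubgroup ↔ ∃ c : ℂ, ρ g = c • 1 := Iff.rfl

instance : (ρ.scalarSubgroup).Normal where
  conj_mem := by
    rintro a ⟨c, hc⟩ g
    refine ⟨c, ?_⟩
    rw [map_mul, map_mul, hc, mul_smul_comm, mul_one, smul_mul_assoc, mul_inv_eq_one]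

theorem exists_mul_eq_of_commutator_mem {y n : G} (h : ⁅y, n⁆ ∈ ρ.scalarSubgroup) :
    ∃ c : ℂ, ρ y * ρ n = c • (ρ n * ρ y) := by
  obtain ⟨c, hc⟩ := h
  refine ⟨c, ?_⟩
  rw [← map_mul, ← map_mul, show y * n = ⁅y, n⁆ * (n * y) by group, map_mul ρ ⁅y, n⁆, hc,
    smul_mul_assoc, one_mul]

end Representation

namespace Representation

open scoped commutatorElement

variable {G V : Type*} [Group G] [AddCommGroup V] [Module ℂ V] {ρ : Representation ℂ G V}

/-- The restriction of `ρ` to `M` has no proper nonzero invariant subspace. -/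
def IsIrreducibleOn (ρ : Representation ℂ G V) (M : Subgroup G) : Prop :=
  ∀ U : Submodule ℂ V, (∀ m ∈ M, ∀ v ∈ U, ρ m v ∈ U) → U = ⊥ ∨ U = ⊤

theorem mul_left_cancel_apply {g : G} {x y : Module.End ℂ V} (h : ρ g * x = ρ g * y) : x = y := by
  rw [← one_mul x, ← one_mul y, ← inv_mul_eq_one ρ g, mul_assoc, h, mul_assoc]

theorem mul_right_cancel_apply {g : G} {x y : Module.End ℂ V} (h : x * ρ g = y * ρ g) : x = y := by
  rw [← mul_one x, ← mul_one y, ← mul_inv_eq_one ρ g, ← mul_assoc, h, mul_assoc]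

theorem IsIrreducibleOn.eq_zero_of_apply_eq_zero {M : Subgroup G} (hM : ρ.IsIrreducibleOn M)
    {c : G → ℂ} {x : Module.End ℂ V} (hc : ∀ m ∈ M, c m ≠ 0)
    (hx : ∀ m ∈ M, ρ m * x = c m • (x * ρ m)) {v : V} (hv : v ≠ 0) (hxv : x v = 0) : x = 0 := by
  have h := (hM (LinearMap.ker x) fun m hm u hu => ?_).resolve_left fun h => hv ?_
  · exact LinearMap.ker_eq_top.1 h
  · have h1 := LinearMap.congr_fun (hx m hm) u
    simp only [Module.End.mul_apply, LinearMap.smul_apply, LinearMap.mem_ker.1 hu, map_zero] at h1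
    exact ((smul_eq_zero.1 h1.symm).resolve_left (hc m hm))
  · rw [← Submodule.mem_bot ℂ, ← h]
    exact hxv

theorem isIrreducibleOn_of_forall_commute [Finite G] (M : Subgroup G)
    (h : ∀ x : Module.End ℂ V, (∀ m ∈ M, Commute (ρ m) x) → ∃ c : ℂ, x = c • 1) :
    ρ.IsIrreducibleOn M := by
  intro U hU
  let σ : Representation ℂ M V := ρ.comp M.subtype
  have : NeZero (Nat.card M : ℂ) := ⟨by exact_mod_cast Nat.card_pos.ne'⟩
  obtain ⟨W, hW⟩ := exists_isCompl (⟨U, fun m v hv => hU m m.2 v hv⟩ : Subrepresentation σ)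
  have hc : IsCompl U W.toSubmodule := by
    refine ⟨disjoint_iff.2 ?_, codisjoint_iff.2 ?_⟩
    · exact congrArg Subrepresentation.toSubmodule hW.inf_eq_bot
    · exact congrArg Subrepresentation.toSubmodule hW.sup_eq_top
  obtain ⟨c, hc'⟩ := h (U.subtype ∘ₗ U.projectionOnto W.toSubmodule hc) fun m hm => by
    refine LinearMap.ext fun v => ?_
    obtain ⟨u, hu, w, hw, rfl⟩ := Submodule.mem_sup.1
      (hc.sup_eq_top ▸ Submodule.mem_top : v ∈ U ⊔ W.toSubmodule)
    have hmw : ρ m w ∈ W.toSubmodule := W.apply_mem_toSubmodule ⟨m, hm⟩ hw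
    simp [Submodule.projectionOnto_apply_of_mem_left hc hu,
      Submodule.projectionOnto_apply_of_mem_right hc hw,
      Submodule.projectionOnto_apply_of_mem_left hc (hU m hm u hu),
      Submodule.projectionOnto_apply_of_mem_right hc hmw]
  by_cases h0 : U = ⊥
  · exact Or.inl h0
  refine Or.inr (Submodule.eq_top_iff'.2 fun v => ?_)
  obtain ⟨u, hu, hu0⟩ := Submodule.exists_mem_ne_zero_of_ne_bot h0
  have h1 := LinearMap.congr_fun hc' u
  have h2 := LinearMap.congr_fun hc' v
  simp only [LinearMap.comp_apply, Submodule.projectionOnto_apply_of_mem_left hc hu,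
    Submodule.subtype_apply, LinearMap.smul_apply, Module.End.one_apply] at h1 h2
  have hc1 : c = 1 := by
    by_contra hne
    have : (1 - c) • u = 0 := by rw [sub_smul, one_smul, ← h1, sub_self]
    exact (smul_eq_zero.1 this).elim (fun h => hne (sub_eq_zero.1 h).symm) hu0
  rw [hc1, one_smul] at h2
  exact h2 ▸ Subtype.property _

variable [FiniteDimensional ℂ V] [Nontrivial V]

theorem IsIrreducibleOn.exists_eq_smul {M : Subgroup G} (hM : ρ.IsIrreducibleOn M) {c : G → ℂ}
    {x y : Module.End ℂ V} (hx0 : x ≠ 0) (hx : ∀ m ∈ M, ρ m * x = c m • (x * ρ m))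
    (hy : ∀ m ∈ M, ρ m * y = c m • (y * ρ m)) : ∃ μ : ℂ, y = μ • x := by
  have hc : ∀ m ∈ M, c m ≠ 0 := by
    intro m hm h
    have h1 := hx m hm
    rw [h, zero_smul, ← mul_zero (ρ m)] at h1
    exact hx0 (mul_left_cancel_apply h1)
  have hinj : Function.Injective x := (injective_iff_map_eq_zero x).2 fun v hv => by
    by_contra hv0
    exact hx0 (hM.eq_zero_of_apply_eq_zero hc hx hv0 hv)
  set e := LinearEquiv.ofInjectiveEndo x hinj with he
  obtain ⟨μ, hμ⟩ := Module.End.exists_eigenvalue (e.symm.toLinearMap * y)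
  obtain ⟨v, hv⟩ := hμ.exists_hasEigenvector
  refine ⟨μ, sub_eq_zero.1 (hM.eq_zero_of_apply_eq_zero hc (fun m hm => ?_) hv.2 ?_)⟩
  · rw [mul_sub, sub_mul, smul_sub, hy m hm, mul_smul_comm, hx m hm, smul_mul_assoc,
      smul_comm μ (c m)]
  · have h1 := congrArg e hv.apply_eq_smul
    rw [Module.End.mul_apply, map_smul] at h1
    have h2 : y v = μ • x v := by simpa [he] using h1
    rw [LinearMap.sub_apply, h2, LinearMap.smul_apply, sub_self]

theorem IsPrimitive.eq_smul_one_of_commutator_mem (hp : ρ.IsPrimitive) (M M' : Subgroup G)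
    [hM' : M'.Normal] (h : ∀ m ∈ M, ∀ g : G, ⁅m, g⁆ ∈ M') (hM : ρ.IsIrreducibleOn M)
    (x : Module.End ℂ V) (hx : ∀ m ∈ M', Commute (ρ m) x) : ∃ c : ℂ, x = c • 1 := by
  let C : Submodule ℂ (Module.End ℂ V) :=
    { carrier := {x | (∀ m ∈ M', Commute (ρ m) x) ∧ LinearMap.trace ℂ V x = 0}
      zero_mem' := ⟨fun m _ => Commute.zero_right _, map_zero _⟩
      add_mem' := fun ha hb => ⟨fun m hm => (ha.1 m hm).add_right (hb.1 m hm), by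
        rw [map_add, ha.2, hb.2, add_zero]⟩
      smul_mem' := fun c a ha => ⟨fun m hm => (ha.1 m hm).smul_right c, by
        rw [map_smul, ha.2, smul_zero]⟩ }
  have hd : (Module.finrank ℂ V : ℂ) ≠ 0 := by exact_mod_cast Module.finrank_pos.ne'
  have hC : C = ⊥ := by
    by_contra hne
    let T : M → Module.End ℂ (Module.End ℂ V) := fun m =>
      LinearMap.mulLeft ℂ (ρ m) ∘ₗ LinearMap.mulRight ℂ (ρ (m : G)⁻¹)
    have hT : ∀ (m : M) (y : Module.End ℂ V), T m y = ρ m * y * ρ (m : G)⁻¹ := fun m y => by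
      simp [T, mul_assoc]
    obtain ⟨y, hyC, hy0, hy⟩ := exists_common_eigenvector T C hne
      (by
        rintro m y ⟨hy, hty⟩
        rw [hT]
        refine ⟨fun k hk => ?_, ?_⟩
        · have h1 : (m : G)⁻¹ * k * m ∈ M' := by simpa using hM'.conj_mem k hk (m : G)⁻¹
          have h2 := hy _ h1
          calc ρ k * (ρ m * y * ρ (m : G)⁻¹)
              = ρ m * (ρ ((m : G)⁻¹ * k * m) * y) * ρ (m : G)⁻¹ := by
                simp only [← mul_assoc, ← map_mul]
                group
            _ = ρ m * (y * ρ ((m : G)⁻¹ * k * m)) * ρ (m : G)⁻¹ := by rw [h2.eq]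
            _ = ρ m * y * ρ (m : G)⁻¹ * ρ k := by
                simp only [mul_assoc, ← map_mul]
                group
        · rw [LinearMap.trace_mul_comm, ← mul_assoc, inv_mul_eq_one, one_mul, hty])
      (by
        rintro m n y ⟨hy, -⟩
        rw [hT, hT, hT, hT]
        have h2 := hy _ (h m m.2 n)
        calc ρ m * (ρ n * y * ρ (n : G)⁻¹) * ρ (m : G)⁻¹
            = ρ (⁅(m : G), (n : G)⁆ * (n * m)) * y * ρ ((n : G)⁻¹ * (m : G)⁻¹) := by
              rw [show ⁅(m : G), (n : G)⁆ * (n * m) = m * n by group]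
              simp only [map_mul, mul_assoc]
          _ = ρ (n * m) * ρ ((n * m : G)⁻¹ * ⁅(m : G), (n : G)⁆ * (n * m)) * y
                * ρ ((n : G)⁻¹ * (m : G)⁻¹) := by
              rw [← map_mul]
              congr 3
              group
          _ = ρ (n * m) * y * (ρ ((n * m : G)⁻¹ * ⁅(m : G), (n : G)⁆ * (n * m))
                * ρ ((n : G)⁻¹ * (m : G)⁻¹)) := by
              rw [mul_assoc (ρ (n * m : G)), (hy _ _).eq]
              · simp only [mul_assoc]
              · simpa using hM'.conj_mem _ (h m m.2 n) (n * m : G)⁻¹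
          _ = ρ n * (ρ m * y * ρ (m : G)⁻¹) * ρ (n : G)⁻¹ := by
              rw [← map_mul, show (n * m : G)⁻¹ * ⁅(m : G), (n : G)⁆ * (n * m)
                * ((n : G)⁻¹ * (m : G)⁻¹) = (m : G)⁻¹ * (n : G)⁻¹ by group]
              simp only [map_mul, mul_assoc])
    choose c hc using hy
    have hrel : ∀ m ∈ M, ρ m * y = (if hm : m ∈ M then c ⟨m, hm⟩ else 0) • (y * ρ m) := by
      intro m hm
      have h1 := hc ⟨m, hm⟩
      rw [hT] at h1
      rw [dif_pos hm, ← smul_mul_assoc, ← h1, mul_assoc, inv_mul_eq_one, mul_one]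
    obtain ⟨μ, hμ⟩ := hp.eq_smul_one_of_forall_mul_eq y fun g => by
      obtain ⟨μ, hμ⟩ := hM.exists_eq_smul (y := ρ g⁻¹ * y * ρ g) hy0 hrel (fun m hm => by
        have hk := hyC.1 _ (h m⁻¹ (inv_mem hm) g)
        calc ρ m * (ρ g⁻¹ * y * ρ g)
            = ρ g⁻¹ * (ρ m * (ρ ⁅m⁻¹, g⁆ * y)) * ρ g := by
              simp only [← mul_assoc, ← map_mul]
              congr 3
              group
          _ = ρ g⁻¹ * (ρ m * y * ρ ⁅m⁻¹, g⁆) * ρ g := by rw [hk.eq, mul_assoc (ρ m)]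
          _ = _ := by
              rw [hrel m hm]
              simp only [mul_smul_comm, smul_mul_assoc, mul_assoc, ← map_mul]
              congr 4
              group)
      refine ⟨μ, ?_⟩
      rw [← mul_smul_comm, ← hμ, ← mul_assoc, ← mul_assoc, mul_inv_eq_one, one_mul]
    have htr := hyC.2
    rw [hμ, map_smul, LinearMap.trace_one, smul_eq_mul, mul_eq_zero] at htr
    refine hy0 ?_
    rw [hμ, htr.resolve_right hd, zero_smul]
  refine ⟨(Module.finrank ℂ V : ℂ)⁻¹ * LinearMap.trace ℂ V x, sub_eq_zero.1 ?_⟩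
  rw [← Submodule.mem_bot ℂ, ← hC]
  refine ⟨fun m hm => (hx m hm).sub_right ((Commute.one_right _).smul_right _), ?_⟩
  rw [map_sub, map_smul, LinearMap.trace_one, smul_eq_mul]
  field_simp
  ring

theorem IsPrimitive.commutator_le_scalarSubgroup (hp : ρ.IsPrimitive) (N : Subgroup G)
    [hN : N.Normal] (hnil : Group.IsNilpotent N) : ⁅N, N⁆ ≤ ρ.scalarSubgroup := by
  have hnorm : ∀ i, (N.lowerCentralSeries i).Normal := by
    intro i
    induction i with
    | zero => exact hN
    | succ i ih => rw [Subgroup.lowerCentralSeries_succ]; infer_instance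
  have hex : ∃ n, N.lowerCentralSeries (n + 1) ≤ ρ.scalarSubgroup := by
    obtain ⟨n, hn⟩ := (Subgroup.isNilpotent_iff_lowerCentralSeries N).1 hnil
    refine ⟨n, (N.lowerCentralSeries_antitone n.le_succ).trans ?_⟩
    rw [hn]
    exact bot_le
  rcases h : Nat.find hex with _ | j
  · have := Nat.find_spec hex
    rwa [h] at this
  · refine absurd ?_ (Nat.find_min hex (m := j) (by omega))
    have hj := Nat.find_spec hex
    rw [h] at hj
    have hle : N.lowerCentralSeries (j + 1) ≤ ⁅N, N⁆ :=
      N.lowerCentralSeries_antitone (show 1 ≤ j + 1 by omega)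
    have key : ∀ y ∈ N.lowerCentralSeries (j + 1), ∀ b ∈ N.lowerCentralSeries (j + 1),
        Commute (ρ y) (ρ b) := by
      intro y hy b hb
      have hy' : ∀ n ∈ N, ∃ c : ℂ, ρ y * ρ n = c • (ρ n * ρ y) := fun n hn =>
        exists_mul_eq_of_commutator_mem (hj (Subgroup.commutator_mem_commutator hy hn))
      let S : Subgroup G :=
        { carrier := {k | Commute (ρ y) (ρ k)}
          one_mem' := by simp
          mul_mem' := fun {a b} ha hb => by
            change Commute _ _
            rw [map_mul]
            exact Commute.mul_right ha hb
          inv_mem' := fun {a} ha => by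
            change Commute _ _
            refine mul_right_cancel_apply (ρ := ρ) (g := a) ?_
            have ha' : ρ y * ρ a = ρ a * ρ y := ha
            rw [mul_assoc, inv_mul_eq_one, mul_one, mul_assoc, ha', ← mul_assoc, inv_mul_eq_one,
              one_mul] }
      have hS : ⁅N, N⁆ ≤ S := Subgroup.commutator_le.2 fun a ha b hb => by
        obtain ⟨c, hc⟩ := hy' a ha
        obtain ⟨d, hd⟩ := hy' b hb
        change ρ y * ρ ⁅a, b⁆ = ρ ⁅a, b⁆ * ρ y
        refine mul_right_cancel_apply (ρ := ρ) (g := b * a) ?_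
        have h1 : ρ y * ρ (b * a) = (d * c) • (ρ (b * a) * ρ y) := by
          rw [map_mul, ← mul_assoc, hd, smul_mul_assoc, mul_assoc, hc, mul_smul_comm, smul_smul,
            mul_assoc]
        have h2 : ρ y * ρ (a * b) = (d * c) • (ρ (a * b) * ρ y) := by
          rw [map_mul, ← mul_assoc, hc, smul_mul_assoc, mul_assoc, hd, mul_smul_comm, smul_smul,
            mul_assoc, mul_comm c]
        rw [mul_assoc (ρ y), ← map_mul, show ⁅a, b⁆ * (b * a) = a * b by group, h2,
          mul_assoc, h1, mul_smul_comm, ← mul_assoc, ← map_mul ρ ⁅a, b⁆,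
          show ⁅a, b⁆ * (b * a) = a * b by group]
      exact hS (hle hb)
    have := hnorm (j + 1)
    exact hp.eq_smul_one_of_commute _ key

theorem IsPrimitive.isIrreducibleOn [Finite G] (hp : ρ.IsPrimitive) (N : Subgroup G)
    [hN : N.Normal] (hnil : Group.IsNilpotent (G ⧸ N)) : ρ.IsIrreducibleOn N := by
  obtain ⟨n, hn⟩ := Subgroup.nilpotent_iff_lowerCentralSeries.1 hnil
  have key : ∀ i, ρ.IsIrreducibleOn
      (((⊤ : Subgroup (G ⧸ N)).lowerCentralSeries i).comap (QuotientGroup.mk' N)) := by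
    intro i
    induction i with
    | zero =>
      intro U hU
      exact hp.eq_bot_or_eq_top U fun g => hU g (Subgroup.mem_top _)
    | succ i ih =>
      refine isIrreducibleOn_of_forall_commute _ fun x hx =>
        hp.eq_smul_one_of_commutator_mem _ _ (fun m hm g => ?_) ih x hx
      rw [Subgroup.mem_comap, map_commutatorElement]
      exact Subgroup.commutator_mem_commutator hm (Subgroup.mem_top _)
  have := key n
  rwa [hn, MonoidHom.comap_bot, QuotientGroup.ker_mk'] at this

end Representation

namespace Representation

open scoped commutatorElement

variable {G V : Type*} [Group G] [AddCommGroup V] [Module ℂ V] {ρ : Representation ℂ G V}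
  [FiniteDimensional ℂ V] [Nontrivial V]

theorem IsIrreducibleOn.mem_scalarSubgroup_of_commute {N : Subgroup G} (hN : ρ.IsIrreducibleOn N)
    {g : G} (h : ∀ n ∈ N, Commute (ρ n) (ρ g)) : g ∈ ρ.scalarSubgroup :=
  hN.exists_eq_smul (c := fun _ => 1) one_ne_zero (fun m _ => by simp)
    fun m hm => by rw [one_smul, (h m hm).eq]

theorem trace_mul_trace_inv_of_mem_scalarSubgroup {g : G} (hg : g ∈ ρ.scalarSubgroup) :
    LinearMap.trace ℂ V (ρ g) * LinearMap.trace ℂ V (ρ g⁻¹) = (Module.finrank ℂ V : ℂ) ^ 2 := by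
  obtain ⟨c, hc⟩ := hg
  obtain ⟨d, hd⟩ := inv_mem (mem_scalarSubgroup.2 ⟨c, hc⟩)
  have h1 := mul_inv_eq_one ρ g
  rw [hc, hd, smul_mul_smul_comm, mul_one] at h1
  have h2 : c * d = 1 := by
    obtain ⟨v, hv⟩ := exists_ne (0 : V)
    have h3 := LinearMap.congr_fun h1 v
    simp only [LinearMap.smul_apply, Module.End.one_apply] at h3
    exact smul_left_injective ℂ hv (by simpa using h3)
  rw [hc, hd, map_smul, map_smul, LinearMap.trace_one, smul_eq_mul, smul_eq_mul]
  linear_combination (Module.finrank ℂ V : ℂ) ^ 2 * h2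

theorem IsIrreducibleOn.trace_eq_zero {N : Subgroup G} (hN : ρ.IsIrreducibleOn N)
    (hcomm : ⁅N, N⁆ ≤ ρ.scalarSubgroup) {n : G} (hn : n ∈ N) (hnZ : n ∉ ρ.scalarSubgroup) :
    LinearMap.trace ℂ V (ρ n) = 0 := by
  have : ∃ h ∈ N, ¬ Commute (ρ h) (ρ n) := by
    by_contra! h
    exact hnZ (hN.mem_scalarSubgroup_of_commute h)
  obtain ⟨h, hh, hne⟩ := this
  obtain ⟨c, hc⟩ := exists_mul_eq_of_commutator_mem
    (hcomm (Subgroup.commutator_mem_commutator hh hn))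
  have hc1 : c ≠ 1 := by
    rintro rfl
    exact hne (by rw [Commute, SemiconjBy, hc, one_smul])
  have h1 : LinearMap.trace ℂ V (ρ n) = c * LinearMap.trace ℂ V (ρ n) := by
    conv_lhs => rw [← one_mul (ρ n), ← inv_mul_eq_one ρ h, mul_assoc, hc, mul_smul_comm, map_smul,
      LinearMap.trace_mul_comm, mul_assoc, mul_inv_eq_one, mul_one, smul_eq_mul]
  have h2 : (1 - c) * LinearMap.trace ℂ V (ρ n) = 0 := by linear_combination h1
  exact (mul_eq_zero.1 h2).resolve_left fun h => hc1 (sub_eq_zero.1 h).symm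

theorem IsIrreducibleOn.relIndex_scalarSubgroup [Finite G] {N : Subgroup G}
    (hN : ρ.IsIrreducibleOn N) (hcomm : ⁅N, N⁆ ≤ ρ.scalarSubgroup) :
    ρ.scalarSubgroup.relIndex N = Module.finrank ℂ V ^ 2 := by
  have : Fintype G := Fintype.ofFinite G
  let σ : Representation ℂ N V := ρ.comp N.subtype
  have hne : (Nat.card N : ℂ) ≠ 0 := by exact_mod_cast Nat.card_pos.ne'
  have hirr : IsIrreducible σ :=
    { exists_pair_ne := ⟨⊥, ⊤, fun h => bot_ne_top (congrArg Subrepresentation.toSubmodule h)⟩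
      eq_bot_or_eq_top := fun U =>
        (hN U.toSubmodule fun m hm v hv => U.apply_mem_toSubmodule ⟨m, hm⟩ hv).imp
          (fun h => Subrepresentation.toSubmodule_injective h)
          (fun h => Subrepresentation.toSubmodule_injective h) }
  have hinv : Invertible (Nat.card N : ℂ) := invertibleOfNonzero hne
  have h1 := card_inv_mul_sum_char_mul_char_eq_finrank σ σ
  rw [IsIrreducible.finrank_intertwiningMap_self, Nat.cast_one, inv_mul_eq_one₀ hne] at h1
  have h2 : ∀ n : N, σ.character n * σ.character n⁻¹ =
      if n ∈ ρ.scalarSubgroup.subgroupOf N then (Module.finrank ℂ V : ℂ) ^ 2 else 0 := by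
    intro n
    split_ifs with h
    · exact trace_mul_trace_inv_of_mem_scalarSubgroup (Subgroup.mem_subgroupOf.1 h)
    · have : σ.character n = 0 :=
        hN.trace_eq_zero hcomm n.2 fun h' => h (Subgroup.mem_subgroupOf.2 h')
      rw [this, zero_mul]
  rw [Finset.sum_congr rfl fun n _ => h2 n, ← Finset.sum_filter, Finset.sum_const, nsmul_eq_mul,
    ← Fintype.card_subtype, ← Nat.card_eq_fintype_card] at h1
  have h3 : Nat.card N = Nat.card (ρ.scalarSubgroup.subgroupOf N) * Module.finrank ℂ V ^ 2 := by
    exact_mod_cast h1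
  rw [← Subgroup.card_mul_index (ρ.scalarSubgroup.subgroupOf N)] at h3
  exact Nat.eq_of_mul_eq_mul_left Nat.card_pos h3

end Representation

section Action

open scoped commutatorElement

theorem Subgroup.card_inf_ker_mul_card_map {W W' : Type*} [Group W] [Group W'] (f : W →* W')
    (A : Subgroup W) :
    Nat.card (f.ker ⊓ A : Subgroup W) * Nat.card (A.map f) = Nat.card A := by
  rw [← Subgroup.relIndex_ker, ← Subgroup.inf_relIndex_right, ← Subgroup.relIndex_bot_left,
    ← Subgroup.relIndex_bot_left A, Subgroup.relIndex_mul_relIndex _ _ _ bot_le inf_le_right]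

theorem Subgroup.card_mul_card_le_of_disjoint {W : Type*} [Group W] [Finite W]
    {A B U : Subgroup W} (hA : A ≤ U) (hB : B ≤ U) (h : Disjoint A B) :
    Nat.card A * Nat.card B ≤ Nat.card U := by
  rw [← Nat.card_prod]
  refine Nat.card_le_card_of_injective
    (fun x : A × B => (⟨x.1 * x.2, mul_mem (hA x.1.2) (hB x.2.2)⟩ : U)) fun x y hxy => ?_
  exact Subgroup.mul_injective_of_disjoint h (congrArg Subtype.val hxy)

variable {Q W : Type*} [Group Q] [CommGroup W] [MulDistribMulAction Q W]

/-- The subgroup of fixed points of a single group element. -/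
def fixedSubgroup (W : Type*) [CommGroup W] [MulDistribMulAction Q W] (g : Q) : Subgroup W where
  carrier := {w | g • w = w}
  one_mem' := smul_one g
  mul_mem' := fun {a b} ha hb => by
    change g • (a * b) = a * b
    rw [smul_mul', ha, hb]
  inv_mem' := fun {a} ha => by
    change g • a⁻¹ = a⁻¹
    rw [smul_inv', ha]

theorem mem_fixedSubgroup {g : Q} {w : W} : w ∈ fixedSubgroup W g ↔ g • w = w := Iff.rfl

/-- The map `w ↦ (g • w) * w⁻¹`. -/
def smulDivHom (W : Type*) [CommGroup W] [MulDistribMulAction Q W] (g : Q) : W →* W where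
  toFun w := g • w * w⁻¹
  map_one' := by simp
  map_mul' a b := by
    rw [smul_mul', mul_inv, mul_mul_mul_comm]

theorem smulDivHom_apply (g : Q) (w : W) : smulDivHom W g w = g • w * w⁻¹ := rfl

theorem ker_smulDivHom (g : Q) : (smulDivHom W g).ker = fixedSubgroup W g := by
  ext w
  rw [MonoidHom.mem_ker, smulDivHom_apply, mul_inv_eq_one, mem_fixedSubgroup]

theorem exists_central_nontrivial_action [Group.IsNilpotent Q] (U : Subgroup W)
    (hU : ∃ g : Q, ∃ u ∈ U, g • u ≠ u) (hinv : ∀ (g : Q), ∀ u ∈ U, g • u ∈ U) :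
    ∃ z : Q, (∃ u ∈ U, z • u ≠ u) ∧ ∀ h : Q, ∀ u ∈ U, z • h • u = h • z • u := by
  have hex : ∃ n, ∀ k ∈ (⊤ : Subgroup Q).lowerCentralSeries n, ∀ u ∈ U, k • u = u := by
    obtain ⟨n, hn⟩ := Subgroup.nilpotent_iff_lowerCentralSeries.1 ‹Group.IsNilpotent Q›
    refine ⟨n, fun k hk u _ => ?_⟩
    rw [hn, Subgroup.mem_bot] at hk
    rw [hk, one_smul]
  rcases hf : Nat.find hex with _ | j
  · have := Nat.find_spec hex
    rw [hf] at this
    obtain ⟨g, u, hu, hgu⟩ := hU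
    exact absurd (this g (Subgroup.mem_top g) u hu) hgu
  · have h1 := Nat.find_min hex (m := j) (by omega)
    push Not at h1
    obtain ⟨z, hz, hzu⟩ := h1
    have h2 := Nat.find_spec hex
    rw [hf] at h2
    refine ⟨z, hzu, fun h u hu => ?_⟩
    have h3 := h2 ⁅z, h⁆ (Subgroup.commutator_mem_commutator hz (Subgroup.mem_top h))
      (h • z • u) (hinv h _ (hinv z u hu))
    rw [← h3, smul_smul, smul_smul, smul_smul]
    congr 1
    group

theorem prod_card_fixedSubgroup_sq_le [Fintype Q] [Group.IsNilpotent Q] [Finite W]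
    (U : Subgroup W) (hinv : ∀ (g : Q), ∀ u ∈ U, g • u ∈ U)
    (hfix : ∀ u ∈ U, (∀ g : Q, g • u = u) → u = 1) :
    (∏ g : Q, Nat.card (fixedSubgroup W g ⊓ U : Subgroup W)) ^ 2 ≤
      Nat.card U ^ Fintype.card Q := by
  induction hn : Nat.card U using Nat.strong_induction_on generalizing U with
  | _ n ih =>
  subst hn
  by_cases hU : U = ⊥
  · subst hU
    simp
  have hU' : ∃ g : Q, ∃ u ∈ U, g • u ≠ u := by
    by_contra! h
    exact hU ((Subgroup.eq_bot_iff_forall U).2 fun u hu => hfix u hu fun g => h g u hu)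
  obtain ⟨z, ⟨u₀, hu₀, hzu₀⟩, hz⟩ := exists_central_nontrivial_action U hU' hinv
  have hcard := Subgroup.card_inf_ker_mul_card_map (smulDivHom W z) U
  rw [ker_smulDivHom] at hcard
  set U₁ : Subgroup W := fixedSubgroup W z ⊓ U with hU₁
  set U₂ : Subgroup W := U.map (smulDivHom W z) with hU₂
  by_cases h1 : U₁ = ⊥
  · have key : ∀ h : Q, Nat.card (fixedSubgroup W h ⊓ U : Subgroup W) *
        Nat.card (fixedSubgroup W (z * h) ⊓ U : Subgroup W) ≤ Nat.card U := by
      intro h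
      refine Subgroup.card_mul_card_le_of_disjoint inf_le_right inf_le_right ?_
      rw [Subgroup.disjoint_def]
      rintro u ⟨hu, huU⟩ ⟨hu', -⟩
      replace hu : h • u = u := hu
      replace hu' : (z * h) • u = u := hu'
      rw [mul_smul, hu] at hu'
      rw [← Subgroup.mem_bot, ← h1]
      exact ⟨hu', huU⟩
    calc (∏ g : Q, Nat.card (fixedSubgroup W g ⊓ U : Subgroup W)) ^ 2
        = (∏ g : Q, Nat.card (fixedSubgroup W g ⊓ U : Subgroup W)) *
            ∏ g : Q, Nat.card (fixedSubgroup W (z * g) ⊓ U : Subgroup W) := by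
          rw [sq]
          congr 1
          exact (Equiv.prod_comp (Equiv.mulLeft z)
            fun g => Nat.card (fixedSubgroup W g ⊓ U : Subgroup W)).symm
      _ ≤ ∏ g : Q, Nat.card U := by
          rw [← Finset.prod_mul_distrib]
          exact Finset.prod_le_prod' fun g _ => key g
      _ = _ := by rw [Finset.prod_const, Finset.card_univ]
  · have hU₁U : U₁ ≤ U := inf_le_right
    have hU₂U : U₂ ≤ U := by
      rintro _ ⟨u, hu, rfl⟩
      exact mul_mem (hinv z u hu) (inv_mem hu)
    have hinv₁ : ∀ (g : Q), ∀ u ∈ U₁, g • u ∈ U₁ := by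
      rintro g u ⟨hu, huU⟩
      refine ⟨?_, hinv g u huU⟩
      change z • g • u = g • u
      rw [hz g u huU, mem_fixedSubgroup.1 hu]
    have hinv₂ : ∀ (g : Q), ∀ u ∈ U₂, g • u ∈ U₂ := by
      rintro g _ ⟨u, hu, rfl⟩
      refine ⟨g • u, hinv g u hu, ?_⟩
      rw [smulDivHom_apply, smulDivHom_apply, smul_mul', smul_inv', hz g u hu]
    have hc1 : 1 < Nat.card U₁ := (Subgroup.one_lt_card_iff_ne_bot _).2 h1
    have hlt₁ : Nat.card U₁ < Nat.card U := by
      refine lt_of_le_of_ne (Subgroup.card_le_of_le hU₁U) fun h => ?_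
      have : U₁ = U := Subgroup.eq_of_le_of_card_ge hU₁U h.ge
      rw [← this] at hu₀
      exact hzu₀ hu₀.1
    have hlt₂ : Nat.card U₂ < Nat.card U := by
      rw [← hcard]
      exact (Nat.lt_mul_iff_one_lt_left Nat.card_pos).2 hc1
    have i1 := ih _ hlt₁ U₁ hinv₁ (fun u hu => hfix u (hU₁U hu)) rfl
    have i2 := ih _ hlt₂ U₂ hinv₂ (fun u hu => hfix u (hU₂U hu)) rfl
    have key : ∀ h : Q, Nat.card (fixedSubgroup W h ⊓ U : Subgroup W) ≤
        Nat.card (fixedSubgroup W h ⊓ U₁ : Subgroup W) *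
          Nat.card (fixedSubgroup W h ⊓ U₂ : Subgroup W) := by
      intro h
      rw [← Subgroup.card_inf_ker_mul_card_map (smulDivHom W z)]
      refine Nat.mul_le_mul (Subgroup.card_le_of_le ?_) (Subgroup.card_le_of_le ?_)
      · rw [ker_smulDivHom, hU₁]
        exact le_of_eq (inf_left_comm _ _ _)
      · rintro _ ⟨u, ⟨hu, huU⟩, rfl⟩
        refine ⟨?_, u, huU, rfl⟩
        change h • (z • u * u⁻¹) = z • u * u⁻¹
        rw [smul_mul', smul_inv', ← hz h u huU, mem_fixedSubgroup.1 hu]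
    calc (∏ g : Q, Nat.card (fixedSubgroup W g ⊓ U : Subgroup W)) ^ 2
        ≤ (∏ g : Q, Nat.card (fixedSubgroup W g ⊓ U₁ : Subgroup W) *
          Nat.card (fixedSubgroup W g ⊓ U₂ : Subgroup W)) ^ 2 :=
          Nat.pow_le_pow_left (Finset.prod_le_prod' fun g _ => key g) 2
      _ ≤ Nat.card U₁ ^ Fintype.card Q * Nat.card U₂ ^ Fintype.card Q := by
          rw [Finset.prod_mul_distrib, mul_pow]
          exact Nat.mul_le_mul i1 i2
      _ = _ := by rw [← mul_pow, hcard]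

theorem exists_card_fixedSubgroup_sq_le [Finite Q] [Group.IsNilpotent Q] [Finite W]
    (U : Subgroup W) (hinv : ∀ (g : Q), ∀ u ∈ U, g • u ∈ U)
    (hfix : ∀ u ∈ U, (∀ g : Q, g • u = u) → u = 1) :
    ∃ g : Q, Nat.card (fixedSubgroup W g ⊓ U : Subgroup W) ^ 2 ≤ Nat.card U := by
  have : Fintype Q := Fintype.ofFinite Q
  by_contra! h
  have h1 := prod_card_fixedSubgroup_sq_le U hinv hfix
  have h2 := Finset.prod_lt_prod_of_nonempty (s := (Finset.univ : Finset Q))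
    (f := fun _ => Nat.card U) (fun _ _ => Nat.card_pos) (fun g _ => h g) Finset.univ_nonempty
  rw [Finset.prod_const, Finset.card_univ, Finset.prod_pow] at h2
  exact absurd h1 h2.not_ge

end Action

section Pairing

variable {Q W : Type*} [Group Q] [CommGroup W] [MulDistribMulAction Q W]

/-- The orthogonality relation `perp` of an invariant anisotropic alternating pairing on `W`: it is
preserved by `Q`, and the only `Q`-invariant isotropic subgroup is trivial. -/
structure IsAnisotropicPerp (Q : Type*) {W : Type*} [Group Q] [CommGroup W]
    [MulDistribMulAction Q W] (perp : W → W → Prop) : Prop where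
  refl : ∀ u, perp u u
  symm : ∀ u v, perp u v → perp v u
  one : ∀ u, perp u 1
  mul : ∀ u v w, perp u v → perp u w → perp u (v * w)
  inv : ∀ u v, perp u v → perp u v⁻¹
  smul : ∀ (g : Q) u v, perp u v → perp (g • u) (g • v)
  smul_mul_inv : ∀ (g : Q) t w, g • t = t → perp t (g • w * w⁻¹)
  eq_one : ∀ U : Subgroup W, (∀ (g : Q), ∀ u ∈ U, g • u ∈ U) → (∀ u ∈ U, ∀ v ∈ U, perp u v) →
    ∀ u ∈ U, u = 1

/-- The subgroup of elements orthogonal to a given one. -/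
def IsAnisotropicPerp.orthogonal {perp : W → W → Prop} (h : IsAnisotropicPerp Q perp) (u : W) :
    Subgroup W where
  carrier := {v | perp u v}
  one_mem' := h.one u
  mul_mem' := h.mul u _ _
  inv_mem' := h.inv u _

theorem IsAnisotropicPerp.eq_one_of_forall_smul_eq {perp : W → W → Prop}
    (h : IsAnisotropicPerp Q perp) {u : W} (hu : ∀ g : Q, g • u = u) : u = 1 := by
  have hle : ∀ v, perp v u → Subgroup.zpowers u ≤ h.orthogonal v := fun v hv =>
    Subgroup.zpowers_le.2 hv
  refine h.eq_one (Subgroup.zpowers u) (fun g v hv => ?_) (fun v hv w hw => ?_) u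
    (Subgroup.mem_zpowers u)
  · obtain ⟨n, rfl⟩ := Subgroup.mem_zpowers_iff.1 hv
    rw [smul_zpow', hu]
    exact Subgroup.zpow_mem_zpowers u n
  · exact hle v (h.symm _ _ (hle u (h.refl u) hv)) hw

theorem IsAnisotropicPerp.smul_eq_of_isPGroup [Finite W] {perp : W → W → Prop}
    (h : IsAnisotropicPerp Q perp) {p : ℕ} [Fact p.Prime] (P : Subgroup W) (hP : IsPGroup p P)
    (hinv : ∀ (g : Q), ∀ u ∈ P, g • u ∈ P) (S : Subgroup Q) [hSn : S.Normal]
    (hS : IsPGroup p S) : ∀ s ∈ S, ∀ w ∈ P, s • w = w := by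
  let D : Subgroup W :=
    { carrier := {w | w ∈ P ∧ ∀ t ∈ P, (∀ s ∈ S, s • t = t) → perp t w}
      one_mem' := ⟨P.one_mem, fun t _ _ => h.one t⟩
      mul_mem' := fun ha hb => ⟨P.mul_mem ha.1 hb.1, fun t ht hts =>
        h.mul _ _ _ (ha.2 t ht hts) (hb.2 t ht hts)⟩
      inv_mem' := fun ha => ⟨P.inv_mem ha.1, fun t ht hts => h.inv _ _ (ha.2 t ht hts)⟩ }
  have hTinv : ∀ (g : Q) (t : W), (∀ s ∈ S, s • t = t) → ∀ s ∈ S, s • g • t = g • t := by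
    intro g t ht s hs
    have h1 := ht (g⁻¹ * s * g) (by simpa using hSn.conj_mem s hs g⁻¹)
    conv_rhs => rw [← h1]
    rw [smul_smul, smul_smul]
    congr 1
    group
  have hDinv : ∀ (g : Q), ∀ w ∈ D, g • w ∈ D := by
    rintro g w ⟨hw, hwt⟩
    refine ⟨hinv g w hw, fun t ht hts => ?_⟩
    have h1 := h.smul g _ _ (hwt (g⁻¹ • t) (hinv g⁻¹ t ht) (hTinv g⁻¹ t hts))
    rwa [smul_inv_smul] at h1
  have hDT : ∀ w ∈ D, (∀ s ∈ S, s • w = w) → w = 1 := by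
    let T : Subgroup W :=
      { carrier := {w | w ∈ D ∧ ∀ s ∈ S, s • w = w}
        one_mem' := ⟨D.one_mem, fun s _ => smul_one s⟩
        mul_mem' := fun ha hb => ⟨D.mul_mem ha.1 hb.1, fun s hs => by
          rw [smul_mul', ha.2 s hs, hb.2 s hs]⟩
        inv_mem' := fun ha => ⟨D.inv_mem ha.1, fun s hs => by
          rw [smul_inv', ha.2 s hs]⟩ }
    intro w hw hws
    exact h.eq_one T (fun g u hu => ⟨hDinv g u hu.1, hTinv g u hu.2⟩)
      (fun u hu v hv => hv.1.2 u hu.1.1 hu.2) w ⟨hw, hws⟩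
  have hD : D = ⊥ := by
    by_contra hne
    let act : MulAction S D :=
      { smul := fun s w => ⟨(s : Q) • (w : W), hDinv s w w.2⟩
        one_smul := fun w => Subtype.ext (one_smul Q (w : W))
        mul_smul := fun a b w => Subtype.ext (mul_smul (a : Q) (b : Q) (w : W)) }
    have hDp : IsPGroup p D := hP.to_le fun w hw => hw.1
    have hdvd : p ∣ Nat.card D := by
      obtain ⟨n, hn⟩ := IsPGroup.iff_card.1 hDp
      have h1 := (Subgroup.one_lt_card_iff_ne_bot D).2 hne
      rw [hn] at h1 ⊢
      refine dvd_pow_self p ?_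
      rintro rfl
      simp at h1
    obtain ⟨b, hb, hne⟩ := hS.exists_fixed_point_of_prime_dvd_card_of_fixed_point (α := D) hdvd
      (a := 1) fun s => Subtype.ext (smul_one (s : Q))
    exact hne (Subtype.ext (hDT b b.2 fun s hs => congrArg Subtype.val (hb ⟨s, hs⟩)).symm)
  intro s hs w hw
  have h1 : s • w * w⁻¹ ∈ D :=
    ⟨P.mul_mem (hinv s w hw) (P.inv_mem hw), fun t _ hts => h.smul_mul_inv s t w (hts s hs)⟩
  rw [hD, Subgroup.mem_bot] at h1
  exact mul_inv_eq_one.1 h1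

theorem pow_smul_eq_of_modEq {Q α : Type*} [Group Q] [MulAction Q α] {g : Q} {a : α} {m k l : ℕ}
    (h : g ^ m • a = a) (hkl : k ≡ l [MOD m]) : g ^ k • a = g ^ l • a := by
  have h1 : k ≡ l [MOD MulAction.period g a] :=
    hkl.of_dvd (MulAction.pow_smul_eq_iff_period_dvd.1 h)
  rw [← MulAction.pow_mod_period_smul k, h1, MulAction.pow_mod_period_smul]

theorem Sylow.smul_mem_of_comm [Finite W] {p : ℕ} [Fact p.Prime] (P : Sylow p W) (g : Q) :
    ∀ u ∈ (P : Subgroup W), g • u ∈ (P : Subgroup W) := by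
  have hc : (P : Subgroup W).Characteristic := P.characteristic_of_normal inferInstance
  intro u hu
  have := hc.fixed (MulDistribMulAction.toMulAut Q W g)
  rw [← this] at hu
  exact hu

theorem IsAnisotropicPerp.exists_smul_eq_smul [Finite Q] [Group.IsNilpotent Q] [Finite W]
    {perp : W → W → Prop} (h : IsAnisotropicPerp Q perp) {p q : ℕ} [Fact p.Prime] [Fact q.Prime]
    (hQ : ∀ r, r.Prime → r ∣ Nat.card Q → r = p ∨ r = q) (A : Sylow p W) (B : Sylow q W)
    (a b : Q) : ∃ g : Q, (∀ w ∈ (A : Subgroup W), g • w = a • w) ∧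
      ∀ w ∈ (B : Subgroup W), g • w = b • w := by
  let S : Sylow p Q := default
  let T : Sylow q Q := default
  have hS : ∀ (g : Q), ∀ w ∈ (A : Subgroup W), g ^ (S : Subgroup Q).index • w = w := fun g =>
    h.smul_eq_of_isPGroup A A.isPGroup' A.smul_mem_of_comm S S.isPGroup' _
      (Subgroup.pow_index_mem _ g)
  have hT : ∀ (g : Q), ∀ w ∈ (B : Subgroup W), g ^ (T : Subgroup Q).index • w = w := fun g =>
    h.smul_eq_of_isPGroup B B.isPGroup' B.smul_mem_of_comm T T.isPGroup' _
      (Subgroup.pow_index_mem _ g)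
  have hcop : Nat.Coprime (S : Subgroup Q).index (T : Subgroup Q).index := by
    refine Nat.coprime_of_dvd fun r hr h1 h2 => ?_
    rcases hQ r hr (h1.trans (Subgroup.index_dvd_card _)) with rfl | rfl
    · exact S.not_dvd_index h1
    · exact T.not_dvd_index h2
  obtain ⟨k, hk1, hk0⟩ := Nat.chineseRemainder hcop 1 0
  obtain ⟨l, hl0, hl1⟩ := Nat.chineseRemainder hcop 0 1
  refine ⟨a ^ k * b ^ l, fun w hw => ?_, fun w hw => ?_⟩
  · rw [mul_smul, pow_smul_eq_of_modEq (hS b w hw) hl0, pow_zero, one_smul,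
      pow_smul_eq_of_modEq (hS a w hw) hk1, pow_one]
  · rw [mul_smul, pow_smul_eq_of_modEq (hT b w hw) hl1, pow_one,
      pow_smul_eq_of_modEq (hT a _ (B.smul_mem_of_comm b w hw)) hk0, pow_zero, one_smul]

theorem pow_dvd_index_of_card_inf_sq_le [Finite W] {p k d : ℕ} [hp : Fact p.Prime]
    (P : Sylow p W) (F : Subgroup W) (hW : Nat.card W = d ^ 2) (hk : p ^ k ∣ d)
    (hF : Nat.card (F ⊓ P : Subgroup W) ^ 2 ≤ Nat.card P) : p ^ k ∣ F.index := by
  have hd : d ≠ 0 := by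
    rintro rfl
    exact Nat.card_pos.ne' hW
  have hcard : Nat.card P = (p ^ d.factorization p) ^ 2 := by
    rw [P.card_eq_multiplicity, hW, Nat.factorization_pow, ← pow_mul, mul_comm]
    rfl
  have hk' : k ≤ d.factorization p := (hp.out.pow_dvd_iff_le_factorization hd).1 hk
  have h1 : Nat.card (F ⊓ P : Subgroup W) * F.relIndex P = Nat.card P := by
    rw [← Subgroup.inf_relIndex_right, ← Subgroup.relIndex_bot_left,
      Subgroup.relIndex_mul_relIndex _ _ _ bot_le inf_le_right, Subgroup.relIndex_bot_left]
  refine dvd_trans ?_ (Subgroup.relIndex_dvd_index_of_normal F (P : Subgroup W))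
  have h2 : F.relIndex P ∣ p ^ (d.factorization p * 2) := by
    rw [pow_mul, ← hcard]
    exact Dvd.intro_left _ h1
  obtain ⟨e, -, he⟩ := (Nat.dvd_prime_pow hp.out).1 h2
  rw [he]
  refine pow_dvd_pow p (hk'.trans ?_)
  rw [hcard] at hF
  have h3 := (Nat.pow_le_pow_iff_left two_ne_zero).1 hF
  rw [he, hcard, sq] at h1
  have h4 : p ^ d.factorization p * p ^ d.factorization p ≤ p ^ d.factorization p * p ^ e :=
    h1 ▸ Nat.mul_le_mul_right _ h3
  exact (Nat.pow_le_pow_iff_right hp.out.one_lt).1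
    (Nat.le_of_mul_le_mul_left h4 (pow_pos hp.out.pos _))

theorem IsAnisotropicPerp.exists_dvd_index [Finite Q] [Group.IsNilpotent Q] [Finite W]
    {perp : W → W → Prop} (h : IsAnisotropicPerp Q perp) {p q : ℕ} [Fact p.Prime] [Fact q.Prime]
    (hQ : ∀ r, r.Prime → r ∣ Nat.card Q → r = p ∨ r = q)
    (hWpq : ∀ r, r.Prime → r ∣ Nat.card W → r = p ∨ r = q)
    {d : ℕ} (hW : Nat.card W = d ^ 2) :
    ∃ g : Q, d ∣ (fixedSubgroup W g).index := by
  let A : Sylow p W := default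
  let B : Sylow q W := default
  obtain ⟨a, ha⟩ := exists_card_fixedSubgroup_sq_le (Q := Q) (A : Subgroup W)
    A.smul_mem_of_comm fun u _ hu => h.eq_one_of_forall_smul_eq hu
  obtain ⟨b, hb⟩ := exists_card_fixedSubgroup_sq_le (Q := Q) (B : Subgroup W)
    B.smul_mem_of_comm fun u _ hu => h.eq_one_of_forall_smul_eq hu
  obtain ⟨g, hga, hgb⟩ := h.exists_smul_eq_smul hQ A B a b
  have key : ∀ (C : Subgroup W) (c : Q), (∀ w ∈ C, g • w = c • w) →
      fixedSubgroup W g ⊓ C = fixedSubgroup W c ⊓ C := by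
    intro C c hc
    ext w
    simp only [Subgroup.mem_inf, mem_fixedSubgroup]
    refine and_congr_left fun hw => ?_
    rw [hc w hw]
  rw [← key _ _ hga] at ha
  rw [← key _ _ hgb] at hb
  refine ⟨g, (Nat.dvd_iff_prime_pow_dvd_dvd _ _).2 fun r k hr hk => ?_⟩
  rcases Nat.eq_zero_or_pos k with rfl | hk0
  · simp
  have hrW : r ∣ Nat.card W := by
    rw [hW, sq]
    exact ((dvd_pow_self r hk0.ne').trans hk).mul_right _
  rcases hWpq r hr hrW with rfl | rfl
  · exact pow_dvd_index_of_card_inf_sq_le A _ hW hk ha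
  · exact pow_dvd_index_of_card_inf_sq_le B _ hW hk hb

end Pairing

section ClassSize

open scoped commutatorElement

theorem Subgroup.relIndex_dvd_index_of_normal_right {G : Type*} [Group G] [Finite G]
    (H K : Subgroup G) [K.Normal] : H.relIndex K ∣ H.index := by
  have h1 : H.relIndex K * K.index = K.relIndex H * H.index := by
    rw [← inf_relIndex_right, relIndex_mul_index inf_le_right, ← inf_relIndex_left,
      relIndex_mul_index inf_le_left]
  have h2 : K.relIndex H * (H ⊔ K).index = K.index := by
    rw [← relIndex_sup_right, relIndex_mul_index le_sup_right]
  refine ⟨(H ⊔ K).index, ?_⟩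
  have h3 : K.relIndex H ≠ 0 := (K.subgroupOf H).index_ne_zero_of_finite
  refine Nat.eq_of_mul_eq_mul_left (Nat.pos_of_ne_zero h3) ?_
  rw [← h1, ← h2]
  ring

theorem classSize_eq_index_centralizer {G : Type*} [Group G] [Finite G] (x : G) :
    classSize x = (Subgroup.centralizer {x}).index := by
  have h1 : (MulAction.stabilizer (ConjAct G) x).index = classSize x := by
    rw [MulAction.index_stabilizer, ← Nat.card_coe_set_eq, classSize]
    refine Nat.card_congr (Equiv.subtypeEquivRight fun y => ?_)
    rw [ConjAct.mem_orbit_conjAct, isConj_comm]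
  rw [← h1, Subgroup.centralizer_eq_comap_stabilizer]
  exact (Subgroup.index_comap_of_surjective _ ConjAct.toConjAct.surjective).symm

/-- The centralizer of an element in a section on which `x` acts by conjugation has index
dividing the size of the conjugacy class of `x`. -/
theorem index_dvd_classSize {G W : Type*} [Group G] [Finite G] [Group W] (N : Subgroup G)
    [hN : N.Normal] (f : N →* W) (hf : Function.Surjective f) (Z : Subgroup G) [hZ : Z.Normal]
    (hker : ∀ n : N, f n = 1 ↔ (n : G) ∈ Z) (x : G) (F : Subgroup W)
    (hF : ∀ n : N, f n ∈ F ↔ f (MulAut.conjNormal x n) = f n) : F.index ∣ classSize x := by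
  let C : Subgroup G := (Subgroup.centralizer {(x : G ⧸ Z)}).comap (QuotientGroup.mk' Z)
  have hC : ∀ y, y ∈ C ↔ ⁅x, y⁆ ∈ Z := fun y => by
    rw [Subgroup.mem_comap, Subgroup.mem_centralizer_singleton_iff, ← QuotientGroup.eq_one_iff,
      QuotientGroup.coe_mk']
    change _ ↔ (QuotientGroup.mk' Z) ⁅x, y⁆ = 1
    rw [map_commutatorElement, commutatorElement_eq_one_iff_mul_comm]
    exact eq_comm
  have h1 : F.comap f = C.subgroupOf N := by
    ext n
    rw [Subgroup.mem_comap, Subgroup.mem_subgroupOf, hF, hC, ← mul_inv_eq_one, ← map_inv,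
      ← map_mul, hker]
    simp [commutatorElement_def]
  rw [← Subgroup.index_comap_of_surjective F hf, h1, classSize_eq_index_centralizer]
  refine (Subgroup.relIndex_dvd_index_of_normal_right C N).trans (Subgroup.index_dvd_of_le ?_)
  intro y hy
  rw [hC]
  have : ⁅x, y⁆ = 1 := by
    rw [commutatorElement_eq_one_iff_mul_comm]
    exact (Subgroup.mem_centralizer_singleton_iff.1 hy).symm
  rw [this]
  exact Z.one_mem

end ClassSize

namespace Representation

open scoped commutatorElement

variable {G V W : Type*} [Group G] [AddCommGroup V] [Module ℂ V] {ρ : Representation ℂ G V}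
  [CommGroup W] {N : Subgroup G}

theorem commute_iff_of_apply_eq {f : N →* W} (hker : ∀ n : N, f n = 1 ↔ (n : G) ∈ ρ.scalarSubgroup)
    {n m n' m' : N} (hn : f n = f n') (hm : f m = f m') (h : Commute (ρ n) (ρ m)) :
    Commute (ρ n') (ρ m') := by
  have key : ∀ a b : N, f a = f b → ∃ c : ℂ, ρ b = c • ρ a := by
    intro a b hab
    obtain ⟨c, hc⟩ := (hker (a⁻¹ * b)).1 (by rw [map_mul, map_inv, hab, inv_mul_cancel])
    refine ⟨c, ?_⟩
    rw [show (b : G) = a * ((a⁻¹ * b : N) : G) by simp, map_mul, hc, mul_smul_comm, mul_one]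
  obtain ⟨c, hc⟩ := key n n' hn
  obtain ⟨d, hd⟩ := key m m' hm
  rw [hc, hd]
  exact (h.smul_left c).smul_right d

variable [FiniteDimensional ℂ V] [Nontrivial V] [hN : N.Normal]

theorem IsPrimitive.isAnisotropicPerp (hp : ρ.IsPrimitive) {f : N →* W}
    (hf : Function.Surjective f) (hker : ∀ n : N, f n = 1 ↔ (n : G) ∈ ρ.scalarSubgroup)
    {φ : G →* MulAut W} (hφ : ∀ x n, φ x (f n) = f (MulAut.conjNormal x n)) :
    IsAnisotropicPerp φ.range fun u v : W =>
      ∀ n m : N, f n = u → f m = v → Commute (ρ n) (ρ m) := by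
  have hiff : ∀ n m : N, (∀ n' m' : N, f n' = f n → f m' = f m → Commute (ρ n') (ρ m')) ↔
      Commute (ρ n) (ρ m) := fun n m =>
    ⟨fun h => h n m rfl rfl, fun h n' m' hn hm =>
      commute_iff_of_apply_eq hker hn.symm hm.symm h⟩
  have hsmul : ∀ (x : G) (n : N), (⟨φ x, x, rfl⟩ : φ.range) • f n = f (MulAut.conjNormal x n) :=
    hφ
  refine ⟨?_, ?_, ?_, ?_, ?_, ?_, ?_, ?_⟩
  · refine hf.forall.2 fun n => ?_
    rw [hiff]
  · exact fun u v h n m hn hm => (h m n hm hn).symm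
  · refine hf.forall.2 fun n => ?_
    rw [← map_one f, hiff]
    simp
  · refine hf.forall.2 fun n => hf.forall.2 fun m => hf.forall.2 fun k h1 h2 => ?_
    rw [← map_mul f]
    rw [hiff] at *
    rw [Subgroup.coe_mul, map_mul]
    exact h1.mul_right h2
  · refine hf.forall.2 fun n => hf.forall.2 fun m h => ?_
    rw [← map_inv f]
    rw [hiff] at *
    refine mul_right_cancel_apply (ρ := ρ) (g := m) ?_
    rw [Subgroup.coe_inv, mul_assoc, inv_mul_eq_one, mul_one, mul_assoc, h.eq, ← mul_assoc,
      inv_mul_eq_one, one_mul]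
  · rintro ⟨_, x, rfl⟩
    refine hf.forall.2 fun n => hf.forall.2 fun m h => ?_
    rw [hsmul, hsmul]
    rw [hiff] at *
    rw [MulAut.conjNormal_apply, MulAut.conjNormal_apply, Commute, SemiconjBy, ← map_mul, ← map_mul,
      show x * n * x⁻¹ * (x * m * x⁻¹) = x * (n * m) * x⁻¹ by group,
      show x * m * x⁻¹ * (x * n * x⁻¹) = x * (m * n) * x⁻¹ by group]
    simp only [map_mul, h.eq]
  · rintro ⟨_, x, rfl⟩
    refine hf.forall.2 fun n => hf.forall.2 fun m h => ?_
    rw [hsmul] at h ⊢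
    rw [← map_inv f, ← map_mul f, hiff]
    obtain ⟨c, hc⟩ := exists_mul_eq_of_commutator_mem (ρ := ρ) (y := n) (n := m) (by
      have h1 : f ⁅n, m⁆ = 1 := by
        rw [map_commutatorElement, commutatorElement_eq_one_iff_mul_comm, mul_comm]
      exact (hker _).1 h1)
    obtain ⟨e, he⟩ := (hker ((MulAut.conjNormal x n)⁻¹ * n)).1
      (by rw [map_mul, map_inv, h, inv_mul_cancel])
    have he' : ρ n = e • ρ (MulAut.conjNormal x n : N) := by
      rw [← mul_one (ρ (MulAut.conjNormal x n : N)), ← mul_smul_comm, ← he, ← map_mul,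
        Subgroup.coe_mul, Subgroup.coe_inv, mul_inv_cancel_left]
    have hc' : ρ (MulAut.conjNormal x n : N) * ρ (MulAut.conjNormal x m : N) =
        c • (ρ (MulAut.conjNormal x m : N) * ρ (MulAut.conjNormal x n : N)) := by
      rw [MulAut.conjNormal_apply, MulAut.conjNormal_apply, ← map_mul, ← map_mul,
        show x * n * x⁻¹ * (x * m * x⁻¹) = x * (n * m) * x⁻¹ by group,
        show x * m * x⁻¹ * (x * n * x⁻¹) = x * (m * n) * x⁻¹ by group]
      simp only [map_mul, hc, mul_smul_comm, smul_mul_assoc]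
    have hc'' : ρ n * ρ (MulAut.conjNormal x m : N) =
        c • (ρ (MulAut.conjNormal x m : N) * ρ n) := by
      rw [he', smul_mul_assoc, hc', mul_smul_comm, smul_comm]
    refine mul_right_cancel_apply (ρ := ρ) (g := m) ?_
    rw [Subgroup.coe_mul, Subgroup.coe_inv, map_mul, mul_assoc, mul_assoc (ρ _) (ρ _) (ρ m),
      inv_mul_eq_one, mul_one, hc'', mul_assoc _ (ρ n), hc, mul_smul_comm, ← mul_assoc,
      mul_assoc (ρ (MulAut.conjNormal x m : N)), inv_mul_eq_one, mul_one]
  · intro U hU hUperp u hu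
    obtain ⟨n, rfl⟩ := hf u
    have hA : ((U.comap f).map N.subtype).Normal := by
      refine ⟨?_⟩
      rintro _ ⟨a, ha, rfl⟩ x
      refine ⟨MulAut.conjNormal x a, ?_, by simp⟩
      change f _ ∈ U
      rw [← hsmul]
      exact hU _ _ ha
    refine (hker n).2 (hp.eq_smul_one_of_commute ((U.comap f).map N.subtype) ?_ n ⟨n, hu, rfl⟩)
    rintro _ ⟨a, ha, rfl⟩ _ ⟨b, hb, rfl⟩
    exact hUperp _ ha _ hb a b rfl rfl

theorem IsPrimitive.exists_finrank_dvd_classSize [Finite G] (hp : ρ.IsPrimitive)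
    (hnil : Group.IsNilpotent N) (hquot : Group.IsNilpotent (G ⧸ N)) {p q : ℕ} [Fact p.Prime]
    [Fact q.Prime] (hG : ∀ r, r.Prime → r ∣ Nat.card G → r = p ∨ r = q)
    {f : N →* W} (hf : Function.Surjective f)
    (hker : ∀ n : N, f n = 1 ↔ (n : G) ∈ ρ.scalarSubgroup)
    {φ : G →* MulAut W} (hφ : ∀ x n, φ x (f n) = f (MulAut.conjNormal x n)) :
    ∃ g : G, Module.finrank ℂ V ∣ classSize g := by
  have hW : Finite W := Finite.of_surjective f hf
  have hcard : Nat.card W = Module.finrank ℂ V ^ 2 := by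
    rw [← (hp.isIrreducibleOn N hquot).relIndex_scalarSubgroup
      (hp.commutator_le_scalarSubgroup N hnil), Subgroup.relIndex,
      show ρ.scalarSubgroup.subgroupOf N = f.ker by
        ext n
        rw [Subgroup.mem_subgroupOf, MonoidHom.mem_ker, hker],
      Subgroup.index_ker, MonoidHom.range_eq_top.2 hf, Subgroup.card_top]
  have hQ : Group.IsNilpotent φ.range := by
    have hle : N ≤ φ.rangeRestrict.ker := by
      intro n hn
      rw [MonoidHom.mem_ker]
      refine Subtype.ext (MulEquiv.ext (hf.forall.2 fun m => ?_))
      change φ n (f m) = f m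
      rw [hφ, show MulAut.conjNormal n m = ⟨n, hn⟩ * m * ⟨n, hn⟩⁻¹ from
        Subtype.ext (MulAut.conjNormal_apply n m), map_mul, map_mul, map_inv, mul_comm (f _),
        mul_inv_cancel_right]
    refine Group.nilpotent_of_surjective (QuotientGroup.lift N φ.rangeRestrict hle) ?_
    exact QuotientGroup.lift_surjective_of_surjective _ _ φ.rangeRestrict_surjective _
  obtain ⟨⟨_, x, rfl⟩, hx⟩ := (hp.isAnisotropicPerp hf hker hφ).exists_dvd_index (p := p) (q := q)
    (fun r hr hd => hG r hr (hd.trans (Subgroup.card_range_dvd φ)))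
    (fun r hr hd => hG r hr ((hd.trans (Subgroup.card_dvd_of_surjective f hf)).trans
      (Subgroup.card_subgroup_dvd_card N))) hcard
  refine ⟨x, hx.trans (index_dvd_classSize N f hf _ hker x _ fun n => ?_)⟩
  rw [mem_fixedSubgroup, ← hφ]
  rfl

end Representation

theorem primitive_char_dvd_class_size_of_metanilpotent {G : Type*} [Group G] [Fintype G]
    (hodd : Odd (Fintype.card G))
    (hmeta : ∃ (N : Subgroup G) (_ : N.Normal), Group.IsNilpotent ↥N ∧ Group.IsNilpotent (G ⧸ N))
    (p₁ p₂ : ℕ) (hne : p₁ ≠ p₂)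
    (hπ : (Fintype.card G).primeFactors = {p₁, p₂})
    (χ : G → ℂ) (hχ : IsPrimitiveChar χ)
    (d : ℕ) (hd : χ 1 = (d : ℂ)) :
    ∃ g : G, d ∣ classSize g := by
  obtain ⟨N, hN, hnil, hquot⟩ := hmeta
  obtain ⟨⟨V, _, _, _, ρ, hV, hirr, hχρ⟩, hprim⟩ := hχ
  obtain rfl : χ = fun g => LinearMap.trace ℂ V (ρ g) := funext hχρ
  have hp : ρ.IsPrimitive := Representation.isPrimitive_of_not_induced ρ hirr hprim
  have hdim : Module.finrank ℂ V = d := by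
    simp only [map_one, LinearMap.trace_one] at hd
    exact_mod_cast hd
  have h₁ : Fact p₁.Prime := ⟨Nat.prime_of_mem_primeFactors (n := Fintype.card G) (by simp [hπ])⟩
  have h₂ : Fact p₂.Prime := ⟨Nat.prime_of_mem_primeFactors (n := Fintype.card G) (by simp [hπ])⟩
  have hG : ∀ r, r.Prime → r ∣ Nat.card G → r = p₁ ∨ r = p₂ := by
    intro r hr hrG
    rw [Nat.card_eq_fintype_card] at hrG
    have : r ∈ (Fintype.card G).primeFactors := hr.mem_primeFactors hrG Fintype.card_ne_zero
    simpa [hπ] using this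
  let π := QuotientGroup.mk' ρ.scalarSubgroup
  have hnormal : (N.map π).Normal := hN.map π (QuotientGroup.mk'_surjective _)
  have hcomm : ∀ a b : N.map π, a * b = b * a := by
    rintro ⟨_, a, ha, rfl⟩ ⟨_, b, hb, rfl⟩
    refine Subtype.ext (commutatorElement_eq_one_iff_mul_comm.1 ?_)
    rw [← map_commutatorElement]
    exact (QuotientGroup.eq_one_iff _).2
      (hp.commutator_le_scalarSubgroup N hnil (Subgroup.commutator_mem_commutator ha hb))
  let _ : CommGroup (N.map π) := { (inferInstance : Group (N.map π)) with mul_comm := hcomm }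
  rw [← hdim]
  refine hp.exists_finrank_dvd_classSize (W := N.map π) hnil hquot hG (f := π.subgroupMap N)
    (φ := MulAut.conjNormal.comp π) (π.subgroupMap_surjective N) (fun n => ?_) fun x n => ?_
  · rw [Subtype.ext_iff]
    exact QuotientGroup.eq_one_iff _
  · refine Subtype.ext ?_
    simp
end

section
/- For all positive integers m and d, λ₃(m·d) ≥ d·λ₃(m) + λ₃(d) and β₃(m·d) ≥ d·β₃(m) + λ₃(d). -/
/-- `β₃(x) = Σ_{i=0}^∞ ⌊x/(2·3^i)⌋`. -/
noncomputable def beta3 (x : ℚ) : ℤ := ∑' i : ℕ, ⌊x / (2 * 3 ^ i)⌋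

/-- `λ₃(x) = Σ_{i=1}^∞ ⌊x/3^i⌋`. -/
noncomputable def lam3 (x : ℚ) : ℤ := ∑' i : ℕ, ⌊x / 3 ^ (i + 1)⌋

theorem floor_natCast_div_three_pow (n i : ℕ) :
    ⌊(n : ℚ) / 3 ^ i⌋ = ((n / 3 ^ i : ℕ) : ℤ) := by
  exact_mod_cast Rat.floor_natCast_div_natCast n (3 ^ i)

theorem summable_natCast_div_three_pow (n : ℕ) :
    Summable fun i : ℕ => ((n / 3 ^ i : ℕ) : ℤ) := by
  refine summable_of_ne_finset_zero (s := Finset.range n) fun i hi => ?_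
  have hni : n ≤ i := by simpa using hi
  have : n < 3 ^ i := hni.trans_lt (Nat.lt_pow_self (by norm_num))
  simp [Nat.div_eq_of_lt this]

theorem tsum_natCast_div_three_pow (n : ℕ) :
    ∑' i : ℕ, ((n / 3 ^ i : ℕ) : ℤ) = n + lam3 n := by
  rw [(summable_natCast_div_three_pow n).tsum_eq_zero_add]
  simp only [lam3, floor_natCast_div_three_pow]
  simp

theorem lam3_natCast_eq_add (n : ℕ) : lam3 n = (n / 3 : ℕ) + lam3 (n / 3 : ℕ) := by
  rw [← tsum_natCast_div_three_pow]
  simp only [lam3, floor_natCast_div_three_pow]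
  simp only [Nat.div_div_eq_div_mul, pow_succ']

theorem beta3_natCast_eq_add (n : ℕ) : beta3 n = (n / 2 : ℕ) + lam3 (n / 2 : ℕ) := by
  rw [← tsum_natCast_div_three_pow]
  refine tsum_congr fun i => ?_
  rw [Nat.div_div_eq_div_mul]
  exact_mod_cast Rat.floor_natCast_div_natCast n (2 * 3 ^ i)

theorem lam3_natCast_eq_padicValNat_factorial (n : ℕ) :
    lam3 n = padicValNat 3 n.factorial := by
  have : Fact (Nat.Prime 3) := ⟨Nat.prime_three⟩
  have hlog : Nat.log 3 n < n + 1 := Nat.lt_succ_of_le (Nat.log_le_self 3 n)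
  rw [padicValNat_factorial hlog, Finset.sum_Ico_eq_sum_range]
  simp only [lam3, floor_natCast_div_three_pow]
  rw [tsum_eq_sum (s := Finset.range n)]
  · simp [add_comm]
  · intro i hi
    have hni : n ≤ i := by simpa using hi
    have : n < 3 ^ (i + 1) :=
      (hni.trans i.le_succ).trans_lt (Nat.lt_pow_self (by norm_num))
    simp [Nat.div_eq_of_lt this]

theorem lam3_natCast_mono {a b : ℕ} (h : a ≤ b) : lam3 a ≤ lam3 b := by
  have : Fact (Nat.Prime 3) := ⟨Nat.prime_three⟩
  rw [lam3_natCast_eq_padicValNat_factorial, lam3_natCast_eq_padicValNat_factorial]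
  exact_mod_cast (padicValNat_dvd_iff_le b.factorial_ne_zero).1
    (pow_padicValNat_dvd.trans (Nat.factorial_dvd_factorial h))

theorem mul_lam3_add_lam3_le {m : ℕ} (hm : m ≠ 0) (d : ℕ) :
    (d : ℤ) * lam3 m + lam3 d ≤ lam3 (m * d : ℕ) := by
  have : Fact (Nat.Prime 3) := ⟨Nat.prime_three⟩
  simp only [lam3_natCast_eq_padicValNat_factorial]
  have hval : padicValNat 3 (m.factorial ^ d * d.factorial) =
      d * padicValNat 3 m.factorial + padicValNat 3 d.factorial := by
    rw [padicValNat.mul (pow_ne_zero _ m.factorial_ne_zero) d.factorial_ne_zero,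
      padicValNat.pow]
  have hdvd : m.factorial ^ d * d.factorial ∣ (m * d).factorial :=
    ⟨Nat.uniformBell d m, by rw [mul_comm m d, ← Nat.uniformBell_mul_eq d hm]; ring⟩
  have := (padicValNat_dvd_iff_le (p := 3) (m * d).factorial_ne_zero).1
    (pow_padicValNat_dvd.trans hdvd)
  rw [hval] at this
  exact_mod_cast this

theorem lam3_natCast_le_beta3 (d : ℕ) : lam3 d ≤ beta3 d := by
  rw [lam3_natCast_eq_add, beta3_natCast_eq_add]
  have h : d / 3 ≤ d / 2 := Nat.div_le_div_left (by norm_num) (by norm_num)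
  exact add_le_add (by exact_mod_cast h) (lam3_natCast_mono h)

theorem lam3_beta3_mul (m d : ℕ) (hm : 0 < m) (hd : 0 < d) :
    (d : ℤ) * lam3 (m : ℚ) + lam3 (d : ℚ) ≤ lam3 ((m : ℚ) * (d : ℚ)) ∧
      (d : ℤ) * beta3 (m : ℚ) + lam3 (d : ℚ) ≤ beta3 ((m : ℚ) * (d : ℚ)) := by
  rw [← Nat.cast_mul]
  refine ⟨mul_lam3_add_lam3_le hm.ne' d, ?_⟩
  obtain hk | hk := eq_or_ne (m / 2) 0
  · obtain rfl : m = 1 := by omega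
    have h1 : beta3 (1 : ℕ) = 0 := by
      rw [beta3_natCast_eq_add]
      simp [lam3]
    rw [h1, one_mul, mul_zero, zero_add]
    exact lam3_natCast_le_beta3 d
  · have hle : m / 2 * d ≤ m * d / 2 := by
      rw [Nat.le_div_iff_mul_le two_pos, mul_right_comm]
      exact Nat.mul_le_mul_right d (Nat.div_mul_le_self m 2)
    have hle' : ((m / 2 : ℕ) : ℤ) * d ≤ (m * d / 2 : ℕ) := by exact_mod_cast hle
    rw [beta3_natCast_eq_add, beta3_natCast_eq_add]
    linarith [mul_lam3_add_lam3_le hk d, lam3_natCast_mono hle]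
end

section
/- For all positive integers m and d, β₃((2/3)·m·d) ≥ d·β₃((2/3)·m) + λ₃(d). -/
theorem lam3_natCast (n : ℕ) : lam3 (n : ℚ) = padicValNat 3 n.factorial := by
  have floor_eq (i : ℕ) : ⌊(n : ℚ) / 3 ^ (i + 1)⌋ = ((n / 3 ^ (i + 1) : ℕ) : ℤ) := by
    exact_mod_cast Rat.floor_natCast_div_natCast n (3 ^ (i + 1))
  have : Fact (Nat.Prime 3) := ⟨Nat.prime_three⟩
  rw [lam3, padicValNat_factorial (Nat.lt_succ_self (Nat.log 3 n)), Finset.sum_Ico_eq_sum_range,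
    tsum_eq_sum (s := Finset.range (Nat.log 3 n))]
  · simp [floor_eq, add_comm]
  · intro i hi
    rw [floor_eq, Nat.div_eq_of_lt]
    · rfl
    · exact Nat.lt_pow_of_log_lt (by norm_num) (by simpa [Nat.lt_succ_iff] using hi)

theorem beta3_two_thirds_mul_eq_lam3 (x : ℚ) : beta3 (2 / 3 * x) = lam3 x := by
  unfold beta3 lam3
  congr! 3 with i
  field_simp
  ring

theorem padicValNat_factorial_mul_ge {p : ℕ} [Fact p.Prime] {m : ℕ} (hm : m ≠ 0) (d : ℕ) :
    d * padicValNat p m.factorial + padicValNat p d.factorial ≤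
      padicValNat p (m * d).factorial := by
  have factorial_eq := Nat.uniformBell_mul_eq d hm
  have bell_ne_zero : d.uniformBell m ≠ 0 := by
    intro h
    simp only [h, zero_mul] at factorial_eq
    exact (d * m).factorial_ne_zero factorial_eq.symm
  have hpow : m.factorial ^ d ≠ 0 := pow_ne_zero _ m.factorial_ne_zero
  rw [mul_comm m d, ← factorial_eq,
    padicValNat.mul (mul_ne_zero bell_ne_zero hpow) d.factorial_ne_zero,
    padicValNat.mul bell_ne_zero hpow, padicValNat.pow]
  lia

theorem beta3_two_thirds_mul (m d : ℕ) (hm : 0 < m) (hd : 0 < d) :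
    (d : ℤ) * beta3 ((2 : ℚ) / 3 * (m : ℚ)) + lam3 (d : ℚ) ≤
      beta3 ((2 : ℚ) / 3 * ((m : ℚ) * (d : ℚ))) := by
  rw [beta3_two_thirds_mul_eq_lam3, beta3_two_thirds_mul_eq_lam3, ← Nat.cast_mul,
    lam3_natCast, lam3_natCast, lam3_natCast]
  have : Fact (Nat.Prime 3) := ⟨Nat.prime_three⟩
  exact_mod_cast padicValNat_factorial_mul_ge hm.ne' d
end

section
/- Let G be a finite group of odd order |G| = p^a · q^b, where p and q are distinct primes, and suppose G has a normal Sylow p-subgroup. Then every primitive irreducible complex character of G has degree a power of p. -/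
open scoped Classical

namespace PrimitiveChar

open Module Submodule

variable {G V : Type*} [Group G] [Finite G] [AddCommGroup V] [Module ℂ V]

/-- The subgroup of elements of `G` that map the subspace `U` into itself. -/
def stab (ρ : Representation ℂ G V) (U : Submodule ℂ V) : Subgroup G where
  carrier := {g | ∀ v ∈ U, ρ g v ∈ U}
  one_mem' := fun v hv => by simpa using hv
  mul_mem' := fun {a b} ha hb v hv => by
    rw [map_mul]
    exact ha _ (hb v hv)
  inv_mem' := fun {g} hg v hv => by
    have key : ∀ k : ℕ, ρ (g ^ k) v ∈ U := fun k => by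
      induction k with
      | zero => simpa using hv
      | succ k ih =>
        rw [pow_succ', map_mul]
        exact hg _ ih
    have h : g⁻¹ = g ^ (orderOf g - 1) := by
      rw [inv_eq_iff_mul_eq_one, ← pow_succ',
        Nat.sub_add_cancel (orderOf_pos g), pow_orderOf_eq_one]
    rw [h]
    exact key _

theorem rho_inv_apply (ρ : Representation ℂ G V) (g : G) (v : V) : ρ g⁻¹ (ρ g v) = v := by
  rw [← Module.End.mul_apply, ← map_mul]
  simp

theorem rho_apply_inv (ρ : Representation ℂ G V) (g : G) (v : V) : ρ g (ρ g⁻¹ v) = v := by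
  rw [← Module.End.mul_apply, ← map_mul]
  simp

/-- The restriction of `ρ` to the subgroup `H` has no proper nonzero invariant subspace. -/
def IrrOn (ρ : Representation ℂ G V) (H : Subgroup G) : Prop :=
  ∀ U : Submodule ℂ V, H ≤ stab ρ U → U = ⊥ ∨ U = ⊤

/-- A primitive representation: any nonzero subspace with independent translates is everything. -/
def Prim (ρ : Representation ℂ G V) : Prop :=
  ∀ U : Submodule ℂ V, U ≠ ⊥ → sSupIndep (Set.range fun g => U.map (ρ g)) → U = ⊤

section

variable [FiniteDimensional ℂ V]

theorem exists_eq_smul_one [Nontrivial V] (ρ : Representation ℂ G V) {N : Subgroup G} {t : G}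
    (hirr : IrrOn ρ (N ⊔ Subgroup.zpowers t)) (x : Module.End ℂ V)
    (hx : ∀ n ∈ N, x * ρ n = ρ n * x) (hxt : x * ρ t = ρ t * x) : ∃ c : ℂ, x = c • 1 := by
  obtain ⟨μ, hμ⟩ := Module.End.exists_eigenvalue x
  have hst : ∀ g, x * ρ g = ρ g * x → g ∈ stab ρ (x.eigenspace μ) := fun g hg v hv => by
    rw [Module.End.mem_eigenspace_iff] at hv ⊢
    rw [← Module.End.mul_apply, hg, Module.End.mul_apply, hv, map_smul]
  rcases hirr (x.eigenspace μ) (sup_le (fun n hn => hst n (hx n hn))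
    (Subgroup.zpowers_le.2 (hst t hxt))) with h | h
  · exact absurd h hμ
  · refine ⟨μ, LinearMap.ext fun v => ?_⟩
    have : v ∈ x.eigenspace μ := h ▸ mem_top
    simpa [Module.End.mem_eigenspace_iff] using this

theorem isUnit_of_twisted (ρ : Representation ℂ G V) {N : Subgroup G} {t : G}
    (hirr : IrrOn ρ (N ⊔ Subgroup.zpowers t)) (x : Module.End ℂ V) (hx0 : x ≠ 0)
    (hx : ∀ n ∈ N, x * ρ n = ρ n * x) {c : ℂ} (hc : c ≠ 0) (hxt : ρ t * x = c • (x * ρ t)) :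
    IsUnit x := by
  have h1 : N ≤ stab ρ (LinearMap.ker x) := fun n hn v hv => by
    rw [LinearMap.mem_ker] at hv ⊢
    rw [← Module.End.mul_apply, hx n hn, Module.End.mul_apply, hv, map_zero]
  have h2 : t ∈ stab ρ (LinearMap.ker x) := fun v hv => by
    rw [LinearMap.mem_ker] at hv ⊢
    have := congrArg (fun f : Module.End ℂ V => f v) hxt
    simp only [Module.End.mul_apply, hv, map_zero, LinearMap.smul_apply] at this
    exact (smul_eq_zero.1 this.symm).resolve_left hc
  rcases hirr _ (sup_le h1 (Subgroup.zpowers_le.2 h2)) with h | h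
  · exact LinearMap.isUnit_iff_ker_eq_bot x |>.2 h
  · exact absurd (LinearMap.ker_eq_top.1 h) hx0

theorem twisted_pow (ρ : Representation ℂ G V) {t : G} {x : Module.End ℂ V} {c : ℂ}
    (hxt : ρ t * x = c • (x * ρ t)) (k : ℕ) : ρ t ^ k * x = c ^ k • (x * ρ t ^ k) := by
  induction k with
  | zero => simp
  | succ k ih =>
    rw [pow_succ', mul_assoc, ih, mul_smul_comm, ← mul_assoc, hxt, smul_mul_assoc, smul_smul,
      mul_assoc, ← pow_succ, ← pow_succ']

/-- Pairs of a unit commuting with `ρ(N)` and a scalar by which conjugation by `ρ t` acts on it. -/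
def twistedUnits (ρ : Representation ℂ G V) (N : Subgroup G) (t : G) (n : ℕ) :
    Subgroup ((Module.End ℂ V)ˣ × rootsOfUnity n ℂ) where
  carrier := {u | (∀ g ∈ N, (u.1 : Module.End ℂ V) * ρ g = ρ g * u.1) ∧
    ρ t * u.1 = ((u.2 : ℂˣ) : ℂ) • ((u.1 : Module.End ℂ V) * ρ t)}
  one_mem' := by simp
  mul_mem' := by
    rintro ⟨u, a⟩ ⟨v, b⟩ ⟨h1, h2⟩ ⟨h3, h4⟩
    refine ⟨fun g hg => ?_, ?_⟩
    · simp only [Prod.mk_mul_mk, Units.val_mul] at *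
      rw [mul_assoc, h3 g hg, ← mul_assoc, h1 g hg, mul_assoc]
    · simp only [Prod.mk_mul_mk, Units.val_mul, Subgroup.coe_mul] at *
      rw [← mul_assoc, h2, smul_mul_assoc, mul_assoc, h4, mul_smul_comm, smul_smul, mul_assoc]
  inv_mem' := by
    rintro ⟨u, a⟩ ⟨h1, h2⟩
    refine ⟨fun g hg => ?_, ?_⟩
    · simp only [Prod.inv_mk] at *
      have := h1 g hg
      rw [Units.inv_mul_eq_iff_eq_mul, ← mul_assoc, this, mul_assoc, Units.mul_inv, mul_one]
    · simp only [Prod.inv_mk, Subgroup.coe_inv] at *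
      rw [Units.mul_inv_eq_iff_eq_mul, smul_mul_assoc, mul_assoc, h2, mul_smul_comm,
        Units.inv_mul_cancel_left, smul_smul]
      simp

theorem commute_of_irrOn_sup [Nontrivial V] (ρ : Representation ℂ G V) {N : Subgroup G}
    [N.Normal] {t : G} (hirr : IrrOn ρ (N ⊔ Subgroup.zpowers t)) (x y : Module.End ℂ V)
    (hx : ∀ n ∈ N, x * ρ n = ρ n * x) (hy : ∀ n ∈ N, y * ρ n = ρ n * y) : x * y = y * x := by
  set n := orderOf t with hn
  have hn0 : n ≠ 0 := (orderOf_pos t).ne'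
  have : NeZero n := ⟨hn0⟩
  have htn : ρ t ^ n = 1 := by rw [← map_pow, pow_orderOf_eq_one, map_one]
  have htt : ρ t * ρ t⁻¹ = 1 := by rw [← map_mul]; simp
  have htt' : ρ t⁻¹ * ρ t = 1 := by rw [← map_mul]; simp
  have hcomm : ∀ a b : twistedUnits ρ N t n, a * b = b * a := by
    refine (MonoidHom.isMulCommutative_of_isCyclic_of_ker_le_center
      ((MonoidHom.snd _ (rootsOfUnity n ℂ)).comp (twistedUnits ρ N t n).subtype) ?_).is_comm.comm
    rintro ⟨⟨u, a⟩, h1, h2⟩ h3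
    have ha : a = 1 := h3
    subst ha
    obtain ⟨c, hc⟩ := exists_eq_smul_one ρ hirr u h1 (by simpa using h2.symm)
    rw [Subgroup.mem_center_iff]
    rintro ⟨⟨v, b⟩, h4⟩
    ext1
    refine Prod.ext (Units.ext ?_) (mul_comm _ _)
    change (v : Module.End ℂ V) * u = u * v
    rw [hc]
    simp
  -- the commutant of `ρ(N)` and its decomposition under conjugation by `ρ t`
  let C : Submodule ℂ (Module.End ℂ V) :=
    { carrier := {x | ∀ n ∈ N, x * ρ n = ρ n * x}
      add_mem' := fun {a b} ha hb n hn => by rw [add_mul, mul_add, ha n hn, hb n hn]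
      zero_mem' := fun n _ => by simp
      smul_mem' := fun c a ha n hn => by rw [smul_mul_assoc, mul_smul_comm, ha n hn] }
  let σ : Module.End ℂ (Module.End ℂ V) :=
    (LinearMap.mulLeft ℂ (ρ t)).comp (LinearMap.mulRight ℂ (ρ t⁻¹))
  have hσ : ∀ z, σ z = ρ t * z * ρ t⁻¹ := fun z => by simp [σ, mul_assoc]
  have hσpow : ∀ (k : ℕ) z, (σ ^ k) z = ρ t ^ k * z * ρ t⁻¹ ^ k := fun k => by
    induction k with
    | zero => simp
    | succ k ih =>
      intro z
      rw [pow_succ', Module.End.mul_apply, ih, hσ, pow_succ' (ρ t), pow_succ (ρ t⁻¹)]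
      simp only [mul_assoc]
  have hσn : σ ^ n = 1 := by
    ext1 z
    rw [hσpow, htn, ← map_pow, inv_pow, pow_orderOf_eq_one]
    simp
  have hσss : ⨆ μ, σ.genEigenspace μ 1 = ⊤ := by
    have hss : σ.IsSemisimple := by
      apply Module.End.isSemisimple_of_squarefree_aeval_eq_zero
        (p := (Polynomial.X ^ n - 1 : Polynomial ℂ))
      · exact (Polynomial.X_pow_sub_one_separable_iff.2 (by exact_mod_cast hn0)).squarefree
      · simp [hσn]
    have h := Module.End.iSup_maxGenEigenspace_eq_top σ
    simpa only [hss.isFinitelySemisimple.maxGenEigenspace_eq_eigenspace] using h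
  have hσC : ∀ z ∈ C, σ z ∈ C := fun z hz m hm => by
    have h1 : t⁻¹ * m * t ∈ N := by
      simpa using Subgroup.Normal.conj_mem (inferInstance : N.Normal) m hm t⁻¹
    have h2 := hz _ h1
    rw [hσ]
    have e1 : ρ t⁻¹ * ρ m = ρ (t⁻¹ * m * t) * ρ t⁻¹ := by
      rw [← map_mul, ← map_mul]; simp
    have e2 : ρ t * ρ (t⁻¹ * m * t) = ρ m * ρ t := by
      rw [← map_mul, ← map_mul]; congr 1; group
    rw [mul_assoc, e1, ← mul_assoc, mul_assoc (ρ t), h2, ← mul_assoc, e2]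
    simp only [mul_assoc]
  have hCdec := Submodule.eq_iSup_inf_genEigenspace 1 hσC hσss
  have hpair : ∀ μ, ∀ z ∈ C ⊓ σ.genEigenspace μ 1, z ≠ 0 →
      ∃ u : twistedUnits ρ N t n, ((u : (Module.End ℂ V)ˣ × rootsOfUnity n ℂ).1 :
        Module.End ℂ V) = z := by
    rintro μ z ⟨hzC, hz⟩ hz0
    have hz' : σ z = μ • z := Module.End.mem_eigenspace_iff.1 hz
    have htw : ρ t * z = μ • (z * ρ t) := by
      rw [← smul_mul_assoc, ← hz', hσ, mul_assoc, htt', mul_one]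
    have hμn : μ ^ n = 1 := by
      have := twisted_pow ρ htw n
      rw [htn, one_mul, mul_one] at this
      by_contra hne
      have h0 : (μ ^ n - 1) • z = 0 := by rw [sub_smul, one_smul, ← this, sub_self]
      exact (smul_eq_zero.1 h0).elim (fun h => hne (sub_eq_zero.1 h)) hz0
    have hμ0 : μ ≠ 0 := by
      rintro rfl
      simp [hn0] at hμn
    obtain ⟨u, hu⟩ := isUnit_of_twisted ρ hirr z hz0 hzC hμ0 htw
    refine ⟨⟨(u, ⟨Units.mk0 μ hμ0, ?_⟩), ?_, ?_⟩, hu⟩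
    · rw [mem_rootsOfUnity]
      ext
      simpa using hμn
    · exact fun g hg => by simpa [hu] using hzC g hg
    · simpa [hu] using htw
  have hhom : ∀ μ ν, ∀ a ∈ C ⊓ σ.genEigenspace μ 1, ∀ b ∈ C ⊓ σ.genEigenspace ν 1,
      a * b = b * a := fun μ ν a ha b hb => by
    rcases eq_or_ne a 0 with rfl | ha0
    · simp
    rcases eq_or_ne b 0 with rfl | hb0
    · simp
    obtain ⟨u, rfl⟩ := hpair μ a ha ha0
    obtain ⟨v, rfl⟩ := hpair ν b hb hb0
    exact congrArg (fun w : twistedUnits ρ N t n =>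
      ((w : (Module.End ℂ V)ˣ × rootsOfUnity n ℂ).1 : Module.End ℂ V)) (hcomm u v)
  let K : Module.End ℂ V → Submodule ℂ (Module.End ℂ V) := fun z =>
    LinearMap.ker (LinearMap.mulLeft ℂ z - LinearMap.mulRight ℂ z)
  have hK : ∀ z w, w ∈ K z ↔ z * w = w * z := fun z w => by
    simp [K, sub_eq_zero]
  have hC1 : ∀ μ, ∀ a ∈ C ⊓ σ.genEigenspace μ 1, C ≤ K a := fun μ a ha => by
    rw [hCdec]
    exact iSup_le fun ν b hb => (hK a b).2 (hhom μ ν a ha b hb)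
  have hC2 : C ≤ K x := by
    rw [hCdec]
    exact iSup_le fun ν b hb => (hK x b).2 ((hK b x).1 (hC1 ν b hb hx)).symm
  exact (hK x y).1 (hC2 hy)

/-- If `U` is invariant under `H`, there is a projection onto `U` commuting with `H`. -/
theorem exists_projection_of_le_stab (ρ : Representation ℂ G V) (H : Subgroup G)
    (U : Submodule ℂ V) (hU : H ≤ stab ρ U) :
    ∃ e : Module.End ℂ V, (∀ v, e v ∈ U) ∧ (∀ v ∈ U, e v = v) ∧ ∀ h ∈ H, e * ρ h = ρ h * e := by
  have := Fintype.ofFinite H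
  obtain ⟨U', hUU'⟩ := U.exists_isCompl
  set f := U.projection U' hUU' with hf
  have hmem : ∀ h ∈ H, ∀ v ∈ U, ρ h v ∈ U := fun h hh => hU hh
  have hcard : (Fintype.card H : ℂ) ≠ 0 := by simp
  refine ⟨(Fintype.card H : ℂ)⁻¹ • ∑ h : H, ρ h * f * ρ (h : G)⁻¹, fun v => ?_, fun v hv => ?_,
    fun h hh => ?_⟩
  · simp only [LinearMap.smul_apply, LinearMap.sum_apply, Module.End.mul_apply]
    exact U.smul_mem _ (U.sum_mem fun h _ =>
      hmem _ h.2 _ (projection_apply_mem _ _))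
  · simp only [LinearMap.smul_apply, LinearMap.sum_apply, Module.End.mul_apply]
    have : ∀ h : H, ρ h (f (ρ (h : G)⁻¹ v)) = v := fun h => by
      rw [hf, projection_apply_of_mem_left _ (hmem _ (H.inv_mem h.2) _ hv), rho_apply_inv]
    simp [this, hcard, ← Nat.cast_smul_eq_nsmul ℂ, smul_smul]
  · rw [smul_mul_assoc, mul_smul_comm, Finset.sum_mul, Finset.mul_sum]
    congr 1
    refine Fintype.sum_equiv (Equiv.mulLeft (⟨h, hh⟩ : H)⁻¹) _ _ fun k => ?_
    simp only [Equiv.coe_mulLeft, Subgroup.coe_mul, Subgroup.coe_inv, mul_inv_rev, inv_inv, map_mul]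
    have h1 : ρ h * ρ h⁻¹ = 1 := by rw [← map_mul]; simp
    simp only [mul_assoc]
    rw [← mul_assoc (ρ h) (ρ h⁻¹), h1, one_mul]

theorem irrOn_of_irrOn_sup [Nontrivial V] (ρ : Representation ℂ G V) (hprim : Prim ρ)
    {N : Subgroup G} [hN : N.Normal] {t : G} (hirr : IrrOn ρ (N ⊔ Subgroup.zpowers t)) :
    IrrOn ρ N := by
  let C := {x : Module.End ℂ V // ∀ n ∈ N, x * ρ n = ρ n * x}
  have hC : ∀ x y : C, Commute x.1 y.1 := fun x y =>
    commute_of_irrOn_sup ρ hirr x y x.2 y.2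
  let f : C → Module.End ℂ V := Subtype.val
  let W : (C → ℂ) → Submodule ℂ V := fun χ => ⨅ i, (f i).maxGenEigenspace (χ i)
  have hW : ∀ χ v, v ∈ W χ ↔ ∀ j, ∃ k : ℕ, ((f j - χ j • 1) ^ k) v = 0 := fun χ v =>
    Module.End.mem_iInf_maxGenEigenspace_iff f χ v
  have hmaps : ∀ i j φ, Set.MapsTo (f i) ((f j).maxGenEigenspace φ) ((f j).maxGenEigenspace φ) :=
    fun i j φ => Module.End.mapsTo_maxGenEigenspace_of_comm (hC j i) φ
  have hind : iSupIndep W := Module.End.independent_iInf_maxGenEigenspace_of_forall_mapsTo f hmaps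
  have htop : ⨆ χ, W χ = ⊤ := Module.End.iSup_iInf_maxGenEigenspace_eq_top_of_forall_mapsTo f hmaps
    fun i => Module.End.iSup_maxGenEigenspace_eq_top _
  have hconj : ∀ (g : G) (x : C), ∀ n ∈ N,
      ρ g⁻¹ * x.1 * ρ g * ρ n = ρ n * (ρ g⁻¹ * x.1 * ρ g) := fun g x n hn => by
    have h1 := x.2 _ (hN.conj_mem n hn g)
    have e1 : ρ g * ρ n = ρ (g * n * g⁻¹) * ρ g := by rw [← map_mul, ← map_mul]; simp
    have e2 : ρ g⁻¹ * ρ (g * n * g⁻¹) = ρ n * ρ g⁻¹ := by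
      rw [← map_mul, ← map_mul]; congr 1; group
    rw [mul_assoc, e1, mul_assoc, ← mul_assoc x.1, h1, ← mul_assoc, ← mul_assoc, e2]
    simp only [mul_assoc]
  let cj : G → C → C := fun g x => ⟨ρ g⁻¹ * x.1 * ρ g, hconj g x⟩
  have hmap : ∀ (g : G) χ, (W χ).map (ρ g) ≤ W (χ ∘ cj g) := fun g χ => by
    rintro _ ⟨v, hv, rfl⟩
    rw [SetLike.mem_coe, hW] at hv
    rw [hW]
    intro j
    obtain ⟨k, hk⟩ := hv (cj g j)
    refine ⟨k, ?_⟩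
    have hs : SemiconjBy (ρ g) (f (cj g j) - χ (cj g j) • 1) (f j - (χ ∘ cj g) j • 1) := by
      have h1 : ρ g * ρ g⁻¹ = 1 := by rw [← map_mul]; simp
      simp only [SemiconjBy, f, cj, Function.comp_apply, mul_sub, sub_mul]
      rw [← mul_assoc, ← mul_assoc, h1, one_mul]
      simp
    have := congrArg (fun F : Module.End ℂ V => F v) (hs.pow_right k).eq
    simp only [Module.End.mul_apply] at this
    rw [← this, hk, map_zero]
  have hmapeq : ∀ (g : G) χ, (W χ).map (ρ g) = W (χ ∘ cj g) := fun g χ => by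
    refine le_antisymm (hmap g χ) fun v hv => ⟨ρ g⁻¹ v, ?_, rho_apply_inv ρ g v⟩
    have h := hmap g⁻¹ (χ ∘ cj g) ⟨v, hv, rfl⟩
    have hid : (χ ∘ cj g) ∘ cj g⁻¹ = χ := by
      funext x
      simp only [Function.comp_apply]
      congr 1
      apply Subtype.ext
      simp only [cj, inv_inv]
      have h1 : ρ g⁻¹ * ρ g = 1 := by rw [← map_mul]; simp
      rw [mul_assoc (ρ g), ← mul_assoc, ← mul_assoc, h1, one_mul, mul_assoc, h1, mul_one]
    rwa [hid] at h
  obtain ⟨χ, hχ⟩ : ∃ χ, W χ ≠ ⊥ := by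
    by_contra! h
    simp [h] at htop
  have hWtop : W χ = ⊤ := hprim _ hχ <| hind.sSupIndep_range.mono <| by
    rintro _ ⟨g, rfl⟩
    exact ⟨_, (hmapeq g χ).symm⟩
  intro U hU
  obtain ⟨e, he1, he2, he3⟩ := exists_projection_of_le_stab ρ N U hU
  by_contra! hne
  obtain ⟨u, huU, hu0⟩ := (Submodule.ne_bot_iff U).1 hne.1
  obtain ⟨w, hw⟩ : ∃ w, w ∉ U := by
    by_contra! h
    exact hne.2 (eq_top_iff.2 fun v _ => h v)
  let i : C := ⟨e, he3⟩
  have hval : ∀ (c : ℂ) (v : V), v ≠ 0 → e v = c • v → χ i = c := fun c v hv hev => by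
    obtain ⟨k, hk⟩ := (hW χ v).1 (hWtop ▸ mem_top) i
    have hp : ∀ k : ℕ, ((f i - χ i • 1) ^ k) v = (c - χ i) ^ k • v := fun k => by
      induction k with
      | zero => simp
      | succ k ih =>
        rw [pow_succ', Module.End.mul_apply, ih, map_smul]
        simp only [f, i, LinearMap.sub_apply, LinearMap.smul_apply, Module.End.one_apply, hev]
        rw [← sub_smul, smul_smul, pow_succ]
    rw [hp] at hk
    exact (sub_eq_zero.1 (eq_zero_of_pow_eq_zero ((smul_eq_zero.1 hk).resolve_right hv))).symm
  have h1 := hval 1 u hu0 (by rw [he2 u huU, one_smul])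
  have h0 := hval 0 (w - e w) (fun h => hw (by rw [sub_eq_zero.1 h]; exact he1 w))
    (by rw [map_sub, he2 _ (he1 w), sub_self, zero_smul])
  exact one_ne_zero (h1.symm.trans h0)

theorem irrOn_of_forall_exists_pow_mem [Nontrivial V] (ρ : Representation ℂ G V) (hprim : Prim ρ)
    (hirr : IrrOn ρ ⊤) {q : ℕ} [Fact q.Prime] (N : Subgroup G) (hN : N.Normal)
    (hq : ∀ g : G, ∃ k : ℕ, g ^ q ^ k ∈ N) : IrrOn ρ N := by
  induction N using WellFoundedGT.induction with
  | ind N ih =>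
  rcases eq_or_ne N ⊤ with rfl | hNtop
  · exact hirr
  have : Nontrivial (G ⧸ N) := by
    rwa [QuotientGroup.nontrivial_iff]
  have hQ : IsPGroup q (G ⧸ N) := fun x => by
    obtain ⟨g, rfl⟩ := QuotientGroup.mk_surjective x
    obtain ⟨k, hk⟩ := hq g
    exact ⟨k, by rwa [← QuotientGroup.mk_pow, QuotientGroup.eq_one_iff]⟩
  have := hQ.center_nontrivial
  obtain ⟨⟨z, hz⟩, hz1⟩ := exists_ne (1 : Subgroup.center (G ⧸ N))
  obtain ⟨t, rfl⟩ := QuotientGroup.mk'_surjective N z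
  have htN : t ∉ N := fun h => hz1 (Subtype.ext ((QuotientGroup.eq_one_iff t).2 h))
  have heq : N ⊔ Subgroup.zpowers t =
      (Subgroup.zpowers (QuotientGroup.mk' N t)).comap (QuotientGroup.mk' N) := by
    rw [← MonoidHom.map_zpowers, QuotientGroup.comap_map_mk']
  have hzn : (Subgroup.zpowers (QuotientGroup.mk' N t)).Normal :=
    ⟨fun a ha g => by
      have := Subgroup.mem_center_iff.1 (Subgroup.zpowers_le.2 hz ha) g
      rwa [this, mul_inv_cancel_right]⟩
  have hnorm : (N ⊔ Subgroup.zpowers t).Normal := heq ▸ inferInstance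
  have hlt : N < N ⊔ Subgroup.zpowers t := lt_of_le_of_ne le_sup_left fun h =>
    htN (h ▸ (le_sup_right : _ ≤ N ⊔ Subgroup.zpowers t) (Subgroup.mem_zpowers t))
  exact irrOn_of_irrOn_sup ρ hprim (t := t) (ih _ hlt hnorm fun g => (hq g).imp fun _ h => hlt.le h)

end

/-- The representation of the stabilizer of `U` on `U`. -/
def subrep (ρ : Representation ℂ G V) (U : Submodule ℂ V) : Representation ℂ (stab ρ U) U where
  toFun g := (ρ g).restrict fun v hv => g.2 v hv
  map_one' := by
    ext v
    simp
  map_mul' g h := by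
    ext v
    simp

theorem mem_stab_iff (ρ : Representation ℂ G V) (U : Submodule ℂ V) (g : G) :
    g ∈ stab ρ U ↔ U.map (ρ g) = U := by
  refine ⟨fun h => le_antisymm ?_ fun v hv => ?_, fun h v hv => ?_⟩
  · rintro _ ⟨v, hv, rfl⟩
    exact h v hv
  · exact ⟨ρ g⁻¹ v, (stab ρ U).inv_mem h v hv, rho_apply_inv ρ g v⟩
  · rw [← h]
    exact ⟨v, hv, rfl⟩

theorem iSup_map_eq_top (ρ : Representation ℂ G V) (hirr : IrrOn ρ ⊤) {U : Submodule ℂ V}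
    (hU : U ≠ ⊥) : ⨆ g, U.map (ρ g) = ⊤ := by
  refine (hirr _ fun g _ => ?_).resolve_left fun h => hU ?_
  · change ∀ v ∈ ⨆ g, U.map (ρ g), _
    suffices h : ⨆ g, U.map (ρ g) ≤ (⨆ g, U.map (ρ g)).comap (ρ g) from h
    refine iSup_le fun x => ?_
    rintro _ ⟨v, hv, rfl⟩
    refine mem_iSup_of_mem (g * x) ⟨v, hv, ?_⟩
    rw [map_mul, Module.End.mul_apply]
  · rw [eq_bot_iff, ← h]
    intro v hv
    exact mem_iSup_of_mem 1 ⟨v, hv, by simp⟩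

theorem isCompl_sSup_diff (ρ : Representation ℂ G V) (hirr : IrrOn ρ ⊤) {U : Submodule ℂ V}
    (hU : U ≠ ⊥) (hind : sSupIndep (Set.range fun g => U.map (ρ g))) :
    IsCompl U (sSup ((Set.range fun g => U.map (ρ g)) \ {U})) := by
  have hmem : U ∈ Set.range fun g => U.map (ρ g) := ⟨1, by simp [Module.End.one_eq_id]⟩
  refine ⟨hind hmem, ?_⟩
  rw [codisjoint_iff, eq_top_iff, ← iSup_map_eq_top ρ hirr hU]
  refine iSup_le fun g => ?_
  by_cases h : U.map (ρ g) = U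
  · exact h.le.trans le_sup_left
  · exact le_sup_of_le_right (le_sSup ⟨⟨g, rfl⟩, h⟩)

theorem irrOn_subrep (ρ : Representation ℂ G V) (hirr : IrrOn ρ ⊤) {U : Submodule ℂ V}
    (hU : U ≠ ⊥) (hind : sSupIndep (Set.range fun g => U.map (ρ g))) :
    IrrOn (subrep ρ U) ⊤ := by
  intro X hX
  by_cases hX0 : X = ⊥
  · exact Or.inl hX0
  right
  set Y : Submodule ℂ V := X.map U.subtype with hY
  have hYU : Y ≤ U := map_subtype_le _ _
  have hY0 : Y ≠ ⊥ := by
    rw [hY, Ne, ← LinearMap.le_ker_iff_map, U.ker_subtype, le_bot_iff]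
    exact hX0
  have hc := isCompl_sSup_diff ρ hirr hU hind
  have htop : Y ⊔ sSup ((Set.range fun g => U.map (ρ g)) \ {U}) = ⊤ := by
    rw [eq_top_iff, ← iSup_map_eq_top ρ hirr hY0]
    refine iSup_le fun g => ?_
    by_cases h : U.map (ρ g) = U
    · refine le_sup_of_le_left ?_
      rintro _ ⟨_, ⟨x, hx, rfl⟩, rfl⟩
      exact ⟨_, hX (Subgroup.mem_top ⟨g, (mem_stab_iff ρ U g).2 h⟩) x hx, rfl⟩
    · exact le_sup_of_le_right ((map_mono hYU).trans (le_sSup ⟨⟨g, rfl⟩, h⟩))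
  have hYeq : Y = U := by
    have := sup_inf_assoc_of_le (sSup ((Set.range fun g => U.map (ρ g)) \ {U})) hYU
    rw [htop, top_inf_eq, inf_comm, hc.inf_eq_bot, sup_bot_eq] at this
    exact this.symm
  rw [eq_top_iff]
  intro u _
  have : (u : V) ∈ Y := hYeq.ge u.2
  obtain ⟨x, hx, hxu⟩ := this
  rwa [← Subtype.ext hxu]

end PrimitiveChar

namespace PrimitiveChar

open Module Submodule

variable {G V : Type*} [Group G] [Fintype G] [AddCommGroup V] [Module ℂ V]

/-- The projection onto `U` along its other translates averages to the identity. -/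
theorem exists_projection_sum_conj (ρ : Representation ℂ G V) (hirr : IrrOn ρ ⊤)
    {U : Submodule ℂ V} (hU : U ≠ ⊥) (hind : sSupIndep (Set.range fun g => U.map (ρ g))) :
    ∃ e : Module.End ℂ V, (∀ v, e v ∈ U) ∧ (∀ v ∈ U, e v = v) ∧
      (∀ g ∉ stab ρ U, ∀ v ∈ U, e (ρ g v) = 0) ∧
      ∑ x : G, ρ x * e * ρ x⁻¹ = (Nat.card (stab ρ U) : ℂ) • 1 := by
  have hc := isCompl_sSup_diff ρ hirr hU hind
  set e := U.projection _ hc with he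
  have h1 : ∀ v, e v ∈ U := projection_apply_mem hc
  have h2 : ∀ v ∈ U, e v = v := fun v hv => projection_apply_of_mem_left hc hv
  have h3 : ∀ g ∉ stab ρ U, ∀ v ∈ U, e (ρ g v) = 0 := fun g hg v hv => by
    have hle : U.map (ρ g) ≤ sSup ((Set.range fun g => U.map (ρ g)) \ {U}) :=
      le_sSup ⟨⟨g, rfl⟩, fun h => hg ((mem_stab_iff ρ U g).2 h)⟩
    exact (projection_apply_eq_zero_iff hc).2 (hle ⟨v, hv, rfl⟩)
  refine ⟨e, h1, h2, h3, ?_⟩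
  rw [← sub_eq_zero, ← LinearMap.ker_eq_top, eq_top_iff, ← iSup_map_eq_top ρ hirr hU]
  refine iSup_le fun y => ?_
  rintro _ ⟨u, hu, rfl⟩
  rw [LinearMap.mem_ker, LinearMap.sub_apply, sub_eq_zero, LinearMap.sum_apply]
  have hterm : ∀ x : G, (ρ x * e * ρ x⁻¹) (ρ y u) =
      if x⁻¹ * y ∈ stab ρ U then ρ y u else 0 := fun x => by
    have hxy : ρ x⁻¹ (ρ y u) = ρ (x⁻¹ * y) u := by rw [map_mul, Module.End.mul_apply]
    rw [Module.End.mul_apply, Module.End.mul_apply, hxy]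
    split_ifs with h
    · rw [h2 _ (h u hu), map_mul, Module.End.mul_apply, rho_apply_inv]
    · rw [h3 _ h u hu, map_zero]
  simp only [hterm, ← Finset.sum_filter, Finset.sum_const]
  rw [LinearMap.smul_apply, Module.End.one_apply, Nat.cast_smul_eq_nsmul]
  congr 1
  rw [Nat.card_eq_fintype_card, ← Finset.card_univ]
  refine Finset.card_bij' (fun x hx => ⟨x⁻¹ * y, (Finset.mem_filter.1 hx).2⟩)
    (fun h _ => y * (h : G)⁻¹) ?_ ?_ ?_ ?_ <;> simp

theorem trace_eq_inducedChar [FiniteDimensional ℂ V] (ρ : Representation ℂ G V)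
    (hirr : IrrOn ρ ⊤) {U : Submodule ℂ V} (hU : U ≠ ⊥)
    (hind : sSupIndep (Set.range fun g => U.map (ρ g))) (g : G) :
    LinearMap.trace ℂ V (ρ g) =
      inducedChar (stab ρ U) (fun h => LinearMap.trace ℂ U (subrep ρ U h)) g := by
  obtain ⟨e, h1, h2, h3, h4⟩ := exists_projection_sum_conj ρ hirr hU hind
  have hout : ∀ y ∉ stab ρ U, LinearMap.trace ℂ V (e * ρ y) = 0 := fun y hy => by
    have hee : e * e = e := LinearMap.ext fun v => h2 _ (h1 v)
    have h0 : e * ρ y * e = 0 := LinearMap.ext fun v => h3 y hy _ (h1 v)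
    rw [← hee, mul_assoc, LinearMap.trace_mul_comm, h0, map_zero]
  have hin : ∀ y : stab ρ U, LinearMap.trace ℂ V (e * ρ y) =
      LinearMap.trace ℂ U (subrep ρ U y) := fun y => by
    have hA : e * ρ y = U.subtype ∘ₗ ((e * ρ y).codRestrict U fun v => h1 _) := rfl
    rw [hA, LinearMap.trace_comp_comm']
    congr 1
    ext u
    exact h2 _ (y.2 u u.2)
  have hsum : (Nat.card (stab ρ U) : ℂ) * LinearMap.trace ℂ V (ρ g) =
      ∑ x : G, LinearMap.trace ℂ V (e * ρ (x⁻¹ * g * x)) := by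
    have : (Nat.card (stab ρ U) : ℂ) • ρ g = ∑ x : G, ρ x * (e * ρ x⁻¹ * ρ g) := by
      rw [← one_mul (ρ g), ← smul_mul_assoc, ← h4, Finset.sum_mul]
      simp only [mul_assoc, one_mul]
    rw [← smul_eq_mul, ← map_smul, this, map_sum]
    refine Finset.sum_congr rfl fun x _ => ?_
    rw [LinearMap.trace_mul_comm, map_mul ρ, map_mul ρ]
    simp only [mul_assoc]
  have hcard : (Nat.card (stab ρ U) : ℂ) ≠ 0 := by
    exact_mod_cast Nat.card_pos.ne'
  rw [inducedChar, eq_inv_mul_iff_mul_eq₀ hcard, hsum]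
  refine Finset.sum_congr rfl fun x _ => ?_
  split_ifs with h
  · exact hin ⟨_, h⟩
  · exact hout _ h

theorem finrank_eq_index_mul [FiniteDimensional ℂ V] (ρ : Representation ℂ G V)
    (hirr : IrrOn ρ ⊤) {U : Submodule ℂ V} (hU : U ≠ ⊥)
    (hind : sSupIndep (Set.range fun g => U.map (ρ g))) :
    finrank ℂ V = (stab ρ U).index * finrank ℂ U := by
  have h := trace_eq_inducedChar ρ hirr hU hind 1
  have hcard : (Nat.card (stab ρ U) : ℂ) ≠ 0 := by
    exact_mod_cast Nat.card_pos.ne'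
  have h1 : ∀ x : G, x⁻¹ * 1 * x = 1 := fun x => by group
  rw [inducedChar, eq_inv_mul_iff_mul_eq₀ hcard, map_one, LinearMap.trace_one] at h
  have h2 : ∀ x : G, (if h : x⁻¹ * 1 * x ∈ stab ρ U then
      LinearMap.trace ℂ U (subrep ρ U ⟨x⁻¹ * 1 * x, h⟩) else 0) = (finrank ℂ U : ℂ) := fun x => by
    have hx : x⁻¹ * 1 * x ∈ stab ρ U := by rw [h1]; exact one_mem _
    rw [dif_pos hx]
    have : (⟨x⁻¹ * 1 * x, hx⟩ : stab ρ U) = 1 := Subtype.ext (h1 x)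
    rw [this, map_one, LinearMap.trace_one]
  simp only [h2, Finset.sum_const, Finset.card_univ, nsmul_eq_mul] at h
  rw [← Nat.card_eq_fintype_card, ← (stab ρ U).card_mul_index] at h
  push_cast at h
  rw [mul_assoc] at h
  exact_mod_cast mul_left_cancel₀ hcard h

end PrimitiveChar

namespace PrimitiveChar

open Module Submodule

theorem finrank_eq_pow_of_isPGroup {p : ℕ} [Fact p.Prime] {G V : Type*} [Group G] [Finite G]
    [AddCommGroup V] [Module ℂ V] [FiniteDimensional ℂ V] [Nontrivial V] (hG : IsPGroup p G)
    (ρ : Representation ℂ G V) (hirr : IrrOn ρ ⊤) : ∃ k : ℕ, finrank ℂ V = p ^ k := by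
  induction hn : finrank ℂ V using Nat.strong_induction_on generalizing G V with
  | _ n ih =>
  subst hn
  by_cases hprim : Prim ρ
  · have hbot := irrOn_of_forall_exists_pow_mem ρ hprim hirr (q := p) ⊥ inferInstance
      fun g => hG g
    obtain ⟨v, hv⟩ := exists_ne (0 : V)
    have h := (hbot (ℂ ∙ v) bot_le).resolve_left (by simpa using hv)
    refine ⟨0, ?_⟩
    rw [← finrank_top, ← h, finrank_span_singleton hv, pow_zero]
  · rw [Prim] at hprim
    push Not at hprim
    obtain ⟨U, hU, hind, hne⟩ := hprim
    have := Fintype.ofFinite G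
    have : Nontrivial U := Submodule.nontrivial_iff_ne_bot.2 hU
    obtain ⟨k, hk⟩ := ih _ (Submodule.finrank_lt hne) (hG.to_subgroup (stab ρ U)) (subrep ρ U)
      (irrOn_subrep ρ hirr hU hind) rfl
    obtain ⟨m, hm⟩ := hG.index (stab ρ U)
    exact ⟨m + k, by rw [finrank_eq_index_mul ρ hirr hU hind, hk, hm, pow_add]⟩

theorem exists_pow_mem_of_card {G : Type*} [Group G] [Fintype G] {p q a b : ℕ} (hp : p.Prime)
    (hcard : Fintype.card G = p ^ a * q ^ b) (P : Sylow p G) (hP : (P : Subgroup G).Normal)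
    (g : G) : ∃ k : ℕ, g ^ q ^ k ∈ (P : Subgroup G) := by
  have := Fact.mk hp
  have hdvd : (P : Subgroup G).index ∣ q ^ b := by
    have h := (P : Subgroup G).index_dvd_card
    rw [Nat.card_eq_fintype_card, hcard] at h
    have hcop := ((Nat.Prime.coprime_iff_not_dvd hp).2 P.not_dvd_index).symm.pow_right a
    exact hcop.dvd_of_dvd_mul_left h
  obtain ⟨c, hc⟩ := hdvd
  refine ⟨b, ?_⟩
  rw [hc, pow_mul]
  exact pow_mem ((P : Subgroup G).pow_index_mem g) c

end PrimitiveChar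

theorem primitive_char_degree_prime_power_of_normal_sylow {G : Type*} [Group G] [Fintype G]
    (p q : ℕ) (hp : p.Prime) (hq : q.Prime) (hpq : p ≠ q) (a b : ℕ)
    (hcard : Fintype.card G = p ^ a * q ^ b) (hodd : Odd (Fintype.card G))
    (P : Sylow p G) (hP : (P : Subgroup G).Normal)
    (χ : G → ℂ) (hχ : IsPrimitiveChar χ)
    (d : ℕ) (hd : χ 1 = (d : ℂ)) :
    ∃ k : ℕ, d = p ^ k := by
  obtain ⟨⟨V, _, _, _, ρ, hV, hirr', hχρ⟩, hχprim⟩ := hχ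
  have := Fact.mk hp
  have := Fact.mk hq
  have hirr : PrimitiveChar.IrrOn ρ ⊤ := fun U hU =>
    hirr' U fun g v hv => hU (Subgroup.mem_top g) v hv
  have hprim : PrimitiveChar.Prim ρ := fun U hU hind => by
    by_contra hne
    refine hχprim (PrimitiveChar.stab ρ U) (fun h => ?_)
      (fun h => LinearMap.trace ℂ U (PrimitiveChar.subrep ρ U h))
      ⟨U, inferInstance, inferInstance, inferInstance, PrimitiveChar.subrep ρ U, fun _ => rfl⟩ ?_
    · exact (hirr U h.ge).elim hU hne
    · funext g
      rw [hχρ, PrimitiveChar.trace_eq_inducedChar ρ hirr hU hind]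
  have hirrP := PrimitiveChar.irrOn_of_forall_exists_pow_mem ρ hprim hirr (q := q) P hP
    (PrimitiveChar.exists_pow_mem_of_card hp hcard P hP)
  obtain ⟨k, hk⟩ := PrimitiveChar.finrank_eq_pow_of_isPGroup P.isPGroup'
    (ρ.comp (P : Subgroup G).subtype) fun U hU =>
      hirrP U fun g hg v hv => hU (Subgroup.mem_top ⟨g, hg⟩) v hv
  refine ⟨k, ?_⟩
  rw [hχρ, map_one, LinearMap.trace_one] at hd
  rw [← hk]
  exact_mod_cast hd.symm
end
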